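/- Let t ≥ 3 and let ν be a (t−1)-wise uniform distribution on {0,1}^k. Consider a random n-variable, m = Δn-constraint distributional CSP in which each constraint chooses a uniformly random scope of k distinct variables and imposes the distribution ν up to a uniformly random negation pattern of the k inputs. Additionally impose the nonrandom distributional constraints: the 0-wise uniform constraints x_1 = b_1, …, x_U = b_U for some string b ∈ {0,1}^U with U = O(√n); and the 1-wise uniform constraints that (x_{U+1}, x_{U+2}) is uniform on {(0,1),(1,0)}, and similarly for the pairs (x_{U+3}, x_{U+4}), …, (x_{n−1}, x_n). Then with probability 1 − o(1), there exists a pseudoexpectation of degree D = Ω(n/(Δ^{2/(t−2)}·log Δ)) that weakly satisfies all of these constraints. -/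

import Mathlib

open MvPolynomial Finset

/-- Probability of an event under the uniform distribution on a finite sample space. -/
noncomputable def uprob {Ω : Type} [Fintype Ω] (p : Ω → Prop) : ℝ :=
  letI := Classical.decPred p
  ((Finset.univ.filter p).card : ℝ) / (Fintype.card Ω : ℝ)

/-- A distribution `μ` on `ι → Bool` is `j`-wise uniform: its marginal on every set of at most
`j` coordinates is uniform. -/
def kwiseUniform {ι : Type} [Fintype ι] [DecidableEq ι] (j : ℕ) (μ : (ι → Bool) → ℝ) : Prop :=
  ∀ A : Finset ι, A.card ≤ j → ∀ a : ι → Bool,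
    ∑ x ∈ Finset.univ.filter (fun x : ι → Bool => ∀ i ∈ A, x i = a i), μ x
      = (1 / 2 : ℝ) ^ A.card

/-- `μ` is a probability distribution on the finite type `α`. -/
def IsDist {α : Type} [Fintype α] (μ : α → ℝ) : Prop :=
  (∀ x, 0 ≤ μ x) ∧ ∑ x, μ x = 1

/-- A degree-`d` pseudoexpectation over `{0,1}`-valued variables `x_1, …, x_n`. -/
structure PE01 (n d : ℕ) where
  pE : MvPolynomial (Fin n) ℝ →ₗ[ℝ] ℝ
  normalized : pE 1 = 1
  multilin : ∀ p q : MvPolynomial (Fin n) ℝ,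
    (∀ x : Fin n → Bool,
        MvPolynomial.eval (fun i => if x i then (1 : ℝ) else 0) p
          = MvPolynomial.eval (fun i => if x i then (1 : ℝ) else 0) q) →
      pE p = pE q
  psd : ∀ p : MvPolynomial (Fin n) ℝ, 2 * p.totalDegree ≤ d → 0 ≤ pE (p ^ 2)

/-- The pseudoexpectation satisfies the identity `Q = b` with pseudovariance zero. -/
def PE01.satEq {n d : ℕ} (E : PE01 n d) (Q : MvPolynomial (Fin n) ℝ) (b : ℝ) : Prop :=
  E.pE Q = b ∧ E.pE (Q ^ 2) = b ^ 2

/-- The multilinear arithmetization of the 0/1-indicator of the event `x_S = a`. -/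
noncomputable def ind01 {n k : ℕ} (S : Fin k → Fin n) (a : Fin k → Bool) :
    MvPolynomial (Fin n) ℝ :=
  ∏ i, (if a i then MvPolynomial.X (S i) else 1 - MvPolynomial.X (S i))

/-- The multilinear arithmetization of the constraint "`P`, applied to the variables of the
scope `S` negated according to the pattern `z`, equals 1". -/
noncomputable def consPoly01 {n k : ℕ} (P : (Fin k → Bool) → Bool)
    (S : Fin k → Fin n) (z : Fin k → Bool) : MvPolynomial (Fin n) ℝ :=
  ∑ a ∈ Finset.univ.filter
      (fun a : Fin k → Bool => P (fun i => Bool.xor (a i) (z i)) = true),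
    ind01 S a


/-- The support of a real-valued weight function on a finite type, as a `Finset`. -/
noncomputable def rsupp {α : Type} [Fintype α] (μ : α → ℝ) : Finset α :=
  letI := Classical.decPred (fun a : α => μ a ≠ 0)
  Finset.univ.filter (fun a : α => μ a ≠ 0)

set_option linter.unusedSectionVars false

section Cube

variable {V : Type} [Fintype V] [DecidableEq V]

/-- The sign `(-1)^b` of a bit. -/
def bsign (b : Bool) : ℝ := if b then -1 else 1

/-- The parity character of the cube indexed by the set `S`. -/
def chi (S : Finset V) (x : V → Bool) : ℝ := ∏ i ∈ S, bsign (x i)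

/-- The average of a function over the cube. -/
noncomputable def avg (f : (V → Bool) → ℝ) : ℝ := (∑ x, f x) / 2 ^ Fintype.card V

lemma bsign_mul_self (b : Bool) : bsign b * bsign b = 1 := by cases b <;> simp [bsign]

lemma bsign_not (b : Bool) : bsign (!b) = -bsign b := by cases b <;> simp [bsign]

lemma bsign_xor (a b : Bool) : bsign (Bool.xor a b) = bsign a * bsign b := by
  cases a <;> cases b <;> simp [bsign]

lemma chi_empty (x : V → Bool) : chi ∅ x = 1 := by simp [chi]

lemma chi_eq_prod_univ (S : Finset V) (x : V → Bool) :
    chi S x = ∏ i, if i ∈ S then bsign (x i) else 1 := by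
  simp [chi, Finset.prod_ite_mem]

lemma chi_mul_chi (S T : Finset V) (x : V → Bool) :
    chi S x * chi T x = chi (symmDiff S T) x := by
  rw [chi_eq_prod_univ, chi_eq_prod_univ, chi_eq_prod_univ, ← Finset.prod_mul_distrib]
  refine Finset.prod_congr rfl fun i _ => ?_
  by_cases h1 : i ∈ S <;> by_cases h2 : i ∈ T <;>
    simp [h1, h2, Finset.mem_symmDiff, bsign_mul_self]

lemma avg_sum {ι : Type*} (s : Finset ι) (f : ι → (V → Bool) → ℝ) :
    avg (fun x => ∑ i ∈ s, f i x) = ∑ i ∈ s, avg (f i) := by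
  simp only [avg]
  rw [Finset.sum_comm, Finset.sum_div]

lemma avg_const_mul (a : ℝ) (f : (V → Bool) → ℝ) :
    avg (fun x => a * f x) = a * avg f := by
  simp only [avg]
  rw [← Finset.mul_sum, mul_div_assoc]

lemma avg_nonneg {f : (V → Bool) → ℝ} (h : ∀ x, 0 ≤ f x) : 0 ≤ avg f :=
  div_nonneg (Finset.sum_nonneg fun x _ => h x) (by positivity)

lemma avg_one : avg (fun _ : V → Bool => (1 : ℝ)) = 1 := by
  simp [avg, Fintype.card_pi]

/-- If `f` does not depend on a coordinate `i ∈ T`, it is uncorrelated with `chi T`. -/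
lemma avg_mul_chi_eq_zero {f : (V → Bool) → ℝ} {T : Finset V} {i : V} (hi : i ∈ T)
    (hf : ∀ x, f (Function.update x i (!x i)) = f x) :
    avg (fun x => f x * chi T x) = 0 := by
  have hinv : Function.Involutive (fun x : V → Bool => Function.update x i (!x i)) := by
    intro x
    simp
  have key : ∀ x : V → Bool, f (Function.update x i (!x i)) * chi T (Function.update x i (!x i))
      = -(f x * chi T x) := by
    intro x
    have h1 : chi T (Function.update x i (!x i)) = -chi T x := by
      rw [chi, chi, ← Finset.mul_prod_erase T _ hi, ← Finset.mul_prod_erase T _ hi]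
      have : ∏ j ∈ T.erase i, bsign (Function.update x i (!x i) j)
          = ∏ j ∈ T.erase i, bsign (x j) := by
        refine Finset.prod_congr rfl fun j hj => ?_
        rw [Function.update_of_ne (Finset.ne_of_mem_erase hj)]
      rw [this, Function.update_self, bsign_not]
      ring
    rw [hf, h1]
    ring
  have h : ∑ x : V → Bool, f x * chi T x = -∑ x : V → Bool, f x * chi T x := by
    rw [← Finset.sum_neg_distrib]
    refine Fintype.sum_equiv hinv.toPerm _ _ fun x => ?_
    have := key x
    simp only [Function.Involutive.coe_toPerm]
    linarith
  simp only [avg]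
  rw [show ∑ x : V → Bool, f x * chi T x = 0 by linarith, zero_div]

lemma avg_chi (S : Finset V) : avg (chi S) = if S = ∅ then 1 else 0 := by
  split_ifs with h
  · subst h
    exact (congrArg avg (funext chi_empty)).trans avg_one
  · obtain ⟨i, hi⟩ := Finset.nonempty_iff_ne_empty.mpr h
    simpa using avg_mul_chi_eq_zero (f := fun _ => 1) hi (fun _ => rfl)

lemma avg_chi_mul_chi (S T : Finset V) :
    avg (fun x => chi S x * chi T x) = if S = T then 1 else 0 := by
  have h : symmDiff S T = ∅ ↔ S = T := symmDiff_eq_bot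
  simp only [chi_mul_chi, ← h]
  exact avg_chi _

lemma sum_chi_mul_chi (x y : V → Bool) :
    ∑ S : Finset V, chi S x * chi S y = if x = y then 2 ^ Fintype.card V else 0 := by
  have h : ∑ S : Finset V, chi S x * chi S y = ∏ i, (1 + bsign (x i) * bsign (y i)) := by
    rw [Finset.prod_one_add]
    simp [chi, Finset.prod_mul_distrib]
  rw [h]
  split_ifs with hxy
  · subst hxy
    simp [bsign_mul_self, Finset.card_univ]
    norm_num
  · obtain ⟨i, hi⟩ := Function.ne_iff.mp hxy
    refine Finset.prod_eq_zero (Finset.mem_univ i) ?_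
    revert hi
    cases x i <;> cases y i <;> simp [bsign]

lemma fourier_inversion (f : (V → Bool) → ℝ) (x : V → Bool) :
    f x = ∑ S : Finset V, avg (fun y => f y * chi S y) * chi S x := by
  have h : ∀ S : Finset V, avg (fun y => f y * chi S y) * chi S x
      = (∑ y, f y * (chi S y * chi S x)) / 2 ^ Fintype.card V := by
    intro S
    rw [avg, div_mul_eq_mul_div, Finset.sum_mul]
    simp only [mul_assoc]
  simp only [h]
  rw [← Finset.sum_div, Finset.sum_comm]
  simp only [← Finset.mul_sum, sum_chi_mul_chi]
  simp

/-- Fourier coefficients of a product as a convolution. -/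
lemma avg_mul_mul_chi (f g : (V → Bool) → ℝ) (R : Finset V) :
    avg (fun x => f x * g x * chi R x)
      = ∑ T : Finset V,
        avg (fun x => g x * chi T x) * avg (fun x => f x * chi (symmDiff R T) x) := by
  have h : ∀ x, f x * g x * chi R x
      = ∑ T : Finset V, avg (fun y => g y * chi T y) * (f x * chi (symmDiff R T) x) := by
    intro x
    conv_lhs => rw [fourier_inversion g x]
    rw [Finset.mul_sum, Finset.sum_mul]
    refine Finset.sum_congr rfl fun T _ => ?_
    rw [← chi_mul_chi]
    ring
  simp only [h]
  rw [avg_sum]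
  simp only [avg_const_mul]

end Cube

section Expansion

variable {V F : Type} [Fintype V] [DecidableEq V] [DecidableEq F]

/-- The data of a family of local densities: `g f` is a nonnegative density with respect to the
uniform measure on the cube, all of whose nonconstant Fourier coefficients live on subsets of
`N f` of size at least `τ f`. -/
structure IsLocalFamily (N : F → Finset V) (τ : F → ℕ) (g : F → (V → Bool) → ℝ) : Prop where
  nonneg : ∀ f x, 0 ≤ g f x
  avg_eq_one : ∀ f, avg (g f) = 1
  supp : ∀ f (T : Finset V), T ≠ ∅ → avg (fun x => g f x * chi T x) ≠ 0 →
    T ⊆ N f ∧ τ f ≤ T.card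

/-- Every set of at most `r` constraints has many variables. -/
def Plausible (N : F → Finset V) (τ : F → ℕ) (z : ℝ) (r : ℕ) : Prop :=
  ∀ C : Finset F, C.card ≤ r →
    2 * ∑ f ∈ C, ((N f).card : ℝ) + z * C.card ≤ 2 * ((C.biUnion N).card : ℝ) + ∑ f ∈ C, (τ f : ℝ)

/-- The product of the centred densities over a set of constraints. -/
noncomputable def centredProd (g : F → (V → Bool) → ℝ) (E : Finset F) (x : V → Bool) : ℝ :=
  ∏ f ∈ E, (g f x - 1)

variable {N : F → Finset V} {τ : F → ℕ} {g : F → (V → Bool) → ℝ}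

lemma IsLocalFamily.centred_supp (hg : IsLocalFamily N τ g) {f : F} {T : Finset V}
    (h : avg (fun x => (g f x - 1) * chi T x) ≠ 0) : T ⊆ N f ∧ τ f ≤ T.card := by
  have e : avg (fun x => (g f x - 1) * chi T x)
      = avg (fun x => g f x * chi T x) - avg (chi T) := by
    simp only [avg, sub_mul, one_mul, Finset.sum_sub_distrib, sub_div]
  rw [e, avg_chi] at h
  by_cases hT : T = ∅
  · subst hT
    simp [chi_empty, show avg (fun x => g f x) = 1 from hg.avg_eq_one f] at h
  · rw [if_neg hT, sub_zero] at h
    exact hg.supp f T hT h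

lemma card_eq_sum_indicator (S : Finset V) : S.card = ∑ v, if v ∈ S then 1 else 0 := by simp

lemma boundary_step (W A R R' T B : Finset V) (hT : T ⊆ A) (hR : R' = symmDiff R T)
    (n m t : ℕ) (ht : t ≤ T.card)
    (ih : 2 * B.card + m + (R' ∩ (W ∪ A)).card ≤ 2 * (W ∪ A).card + n + (R' \ (W ∪ A)).card) :
    2 * B.card + (t + m) + (R ∩ W).card ≤ 2 * W.card + (2 * A.card + n) + (R \ W).card := by
  have key : 2 * (W ∪ A).card + T.card + (R' \ (W ∪ A)).card + (R ∩ W).card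
      ≤ 2 * W.card + 2 * A.card + (R \ W).card + (R' ∩ (W ∪ A)).card := by
    simp only [card_eq_sum_indicator, Finset.mul_sum, ← Finset.sum_add_distrib]
    refine Finset.sum_le_sum fun v _ => ?_
    have := @hT v
    subst hR
    by_cases h1 : v ∈ W <;> by_cases h2 : v ∈ A <;> by_cases h3 : v ∈ R <;> by_cases h4 : v ∈ T <;>
      simp_all [Finset.mem_symmDiff]
  omega

/-- A nonvanishing Fourier coefficient of a product of centred densities forces the set of
constraints to add few variables to any given set `W`. -/
lemma IsLocalFamily.boundary_le (hg : IsLocalFamily N τ g) (E : Finset F) :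
    ∀ R : Finset V, avg (fun x => centredProd g E x * chi R x) ≠ 0 → ∀ W : Finset V,
      2 * (W ∪ E.biUnion N).card + ∑ f ∈ E, τ f + (R ∩ W).card
        ≤ 2 * W.card + 2 * ∑ f ∈ E, (N f).card + (R \ W).card := by
  induction E using Finset.induction_on with
  | empty =>
    intro R h W
    have : R = ∅ := by
      by_contra hR
      exact h (by simpa [centredProd, hR] using avg_chi R)
    subst this
    simp
  | insert f E hf ih =>
    intro R h W
    have e : ∀ x, centredProd g (insert f E) x = centredProd g E x * (g f x - 1) := by
      intro x
      rw [centredProd, Finset.prod_insert hf, mul_comm]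
      rfl
    simp only [e, avg_mul_mul_chi] at h
    obtain ⟨T, -, hT⟩ := Finset.exists_ne_zero_of_sum_ne_zero h
    obtain ⟨h1, h2⟩ := hg.centred_supp (left_ne_zero_of_mul hT)
    have := ih _ (right_ne_zero_of_mul hT) (W ∪ N f)
    rw [Finset.sum_insert hf, Finset.sum_insert hf, Finset.biUnion_insert, ← Finset.union_assoc,
      mul_add]
    exact boundary_step W (N f) R _ T _ h1 rfl _ _ _ h2 this

/-- Small products of centred densities have no low-degree Fourier coefficients. -/
lemma IsLocalFamily.degree_gap (hg : IsLocalFamily N τ g) {z : ℝ} {r : ℕ}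
    (hp : Plausible N τ z r) {E : Finset F} (hE : E.card ≤ r) {R : Finset V}
    (h : avg (fun x => centredProd g E x * chi R x) ≠ 0) : z * E.card ≤ R.card := by
  have h1 := hg.boundary_le E R h ∅
  have h2 := hp E hE
  simp only [Finset.empty_union, Finset.inter_empty, Finset.card_empty, Finset.sdiff_empty] at h1
  have h3 : (2 * ((E.biUnion N).card : ℝ) + ∑ f ∈ E, (τ f : ℝ)) ≤
      2 * ∑ f ∈ E, ((N f).card : ℝ) + R.card := by
    exact_mod_cast (by omega : 2 * (E.biUnion N).card + ∑ f ∈ E, τ f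
      ≤ 2 * ∑ f ∈ E, (N f).card + R.card)
  linarith

/-- `C` is closed around `W`: no small set of further constraints interacts more with `W` than
with its complement. -/
def IsClosedAround (g : F → (V → Bool) → ℝ) (M : ℕ) (C : Finset F) (W : Finset V) : Prop :=
  ∀ E : Finset F, E.Nonempty → Disjoint E C → E.card ≤ M → ∀ R : Finset V,
    avg (fun x => centredProd g E x * chi R x) ≠ 0 → (R ∩ W).card < (R \ W).card

lemma IsLocalFamily.exists_closure [Fintype F] (hg : IsLocalFamily N τ g) {z : ℝ} (hz : 0 < z)
    {M : ℕ} (hp : Plausible N τ z (2 * M)) (A : Finset V) (hA : 2 * (A.card : ℝ) ≤ z * M) :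
    ∃ C : Finset F, C.card ≤ M ∧ IsClosedAround g M C (A ∪ C.biUnion N) := by
  classical
  let P : Finset F → Prop := fun C => C.card ≤ 2 * M ∧
    2 * (A ∪ C.biUnion N).card + ∑ f ∈ C, τ f ≤ 2 * A.card + 2 * ∑ f ∈ C, (N f).card
  have hP0 : (Finset.univ.filter P).Nonempty := ⟨∅, by simp [P]⟩
  obtain ⟨C, hC, hmax⟩ := Finset.exists_max_image _ Finset.card hP0
  simp only [Finset.mem_filter, Finset.mem_univ, true_and] at hC hmax
  have hCM : C.card ≤ M := by
    have h2 := hp C hC.1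
    have h3 : 2 * (C.biUnion N).card + ∑ f ∈ C, τ f ≤ 2 * A.card + 2 * ∑ f ∈ C, (N f).card := by
      have := Finset.card_le_card (Finset.subset_union_right (s₁ := A) (s₂ := C.biUnion N))
      have := hC.2
      omega
    have h4 : 2 * ((C.biUnion N).card : ℝ) + ∑ f ∈ C, (τ f : ℝ)
        ≤ 2 * A.card + 2 * ∑ f ∈ C, ((N f).card : ℝ) := by exact_mod_cast h3
    have : z * C.card ≤ z * M := by linarith
    exact_mod_cast le_of_mul_le_mul_left this hz
  refine ⟨C, hCM, fun E hE hEC hEM R hR => ?_⟩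
  by_contra hlt
  have h1 := hg.boundary_le E R hR (A ∪ C.biUnion N)
  have hPC : P (C ∪ E) := by
    refine ⟨(Finset.card_union_le _ _).trans (by omega), ?_⟩
    rw [Finset.sum_union hEC.symm, Finset.sum_union hEC.symm, Finset.union_biUnion,
      ← Finset.union_assoc]
    have := hC.2
    omega
  have h5 := hmax _ hPC
  rw [Finset.card_union_of_disjoint hEC.symm] at h5
  have := hE.card_pos
  omega

end Expansion

section Pseudo

variable {V F : Type} [Fintype V] [DecidableEq V] [DecidableEq F]
variable {N : F → Finset V} {τ : F → ℕ} {g : F → (V → Bool) → ℝ}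

/-- The true density of the constraints in `C`. -/
noncomputable def localDensity (g : F → (V → Bool) → ℝ) (C : Finset F) (x : V → Bool) : ℝ :=
  ∏ f ∈ C, g f x

lemma localDensity_eq_sum (C : Finset F) (x : V → Bool) :
    localDensity g C x = ∑ E ∈ C.powerset, centredProd g E x := by
  have := Finset.prod_add_one (s := C) (f := fun f => g f x - 1)
  simpa [localDensity, centredProd] using this

lemma biUnion_dependence (hg : IsLocalFamily N τ g) (f : F) {i : V} (hi : i ∉ N f)
    (x : V → Bool) : g f (Function.update x i (!x i)) = g f x := by
  rw [fourier_inversion (g f) (Function.update x i (!x i)), fourier_inversion (g f) x]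
  refine Finset.sum_congr rfl fun T _ => ?_
  by_cases h0 : avg (fun y => g f y * chi T y) = 0
  · simp [h0]
  · congr 1
    by_cases hT : T = ∅
    · simp [hT, chi_empty]
    · refine Finset.prod_congr rfl fun j hj => ?_
      rw [Function.update_of_ne]
      rintro rfl
      exact hi ((hg.supp f T hT h0).1 hj)

variable [Fintype F]

/-- The expansion of the product of all densities, truncated to at most `M` centred factors. -/
noncomputable def pseudoDensity (g : F → (V → Bool) → ℝ) (M : ℕ) (x : V → Bool) : ℝ :=
  ∑ E : Finset F with E.card ≤ M, centredProd g E x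

/-- The truncated expansion over the constraints outside `C`. -/
noncomputable def outerDensity (g : F → (V → Bool) → ℝ) (M : ℕ) (C : Finset F)
    (x : V → Bool) : ℝ :=
  ∑ E ∈ Cᶜ.powerset with E.card ≤ M, centredProd g E x

lemma localDensity_mul_outerDensity (M : ℕ) (C : Finset F) (x : V → Bool) :
    localDensity g C x * outerDensity g M C x
      = ∑ E : Finset F with (E \ C).card ≤ M, centredProd g E x := by
  rw [localDensity_eq_sum, outerDensity, Finset.sum_mul_sum, ← Finset.sum_product']
  symm
  refine Finset.sum_nbij' (fun E => (E ∩ C, E \ C)) (fun p => p.1 ∪ p.2) ?_ ?_ ?_ ?_ ?_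
  · intro E hE
    simp only [Finset.mem_filter, Finset.mem_univ, true_and] at hE
    simp only [Finset.mem_product, Finset.mem_powerset, Finset.mem_filter]
    refine ⟨Finset.inter_subset_right, fun f hf => ?_, hE⟩
    simp only [Finset.mem_sdiff] at hf
    simpa using hf.2
  · rintro ⟨E₁, E₂⟩ h
    simp only [Finset.mem_product, Finset.mem_powerset, Finset.mem_filter] at h
    simp only [Finset.mem_filter, Finset.mem_univ, true_and]
    refine (Finset.card_le_card fun f hf => ?_).trans h.2.2
    simp only [Finset.mem_sdiff, Finset.mem_union] at hf
    exact hf.1.resolve_left fun h' => hf.2 (h.1 h')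
  · intro E _
    ext f
    simp only [Finset.mem_union, Finset.mem_inter, Finset.mem_sdiff]
    tauto
  · rintro ⟨E₁, E₂⟩ h
    simp only [Finset.mem_product, Finset.mem_powerset, Finset.mem_filter] at h
    have h2 : ∀ f ∈ E₂, f ∉ C := fun f hf => by simpa using h.2.1 hf
    have h1 : ∀ f ∈ E₁, f ∈ C := fun f hf => h.1 hf
    refine Prod.ext (Finset.ext fun f => ?_) (Finset.ext fun f => ?_) <;>
      simp only [Finset.mem_union, Finset.mem_inter, Finset.mem_sdiff] <;>
      have a1 := h1 f <;> have a2 := h2 f <;> tauto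
  · intro E _
    simp only [centredProd]
    rw [← Finset.prod_union (Finset.disjoint_left.mpr fun f h1 h2 => ?_)]
    · congr 1
      ext f
      simp only [Finset.mem_union, Finset.mem_inter, Finset.mem_sdiff]
      tauto
    · exact (Finset.mem_sdiff.mp h2).2 (Finset.mem_inter.mp h1).2

lemma avg_pseudoDensity_chi (M : ℕ) (R : Finset V) :
    avg (fun x => pseudoDensity g M x * chi R x)
      = ∑ E : Finset F with E.card ≤ M, avg (fun x => centredProd g E x * chi R x) := by
  simp only [pseudoDensity, Finset.sum_mul]
  rw [avg_sum]

/-- Against low-degree characters the truncation may be taken over the outer constraints only. -/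
lemma IsLocalFamily.avg_pseudoDensity_eq (hg : IsLocalFamily N τ g) {z : ℝ} (hz : 0 < z) {M : ℕ}
    (hp : Plausible N τ z (2 * M)) {C : Finset F} (hC : C.card ≤ M) {R : Finset V}
    (hR : (R.card : ℝ) ≤ z * M) :
    avg (fun x => pseudoDensity g M x * chi R x)
      = avg (fun x => localDensity g C x * outerDensity g M C x * chi R x) := by
  simp only [localDensity_mul_outerDensity, Finset.sum_mul]
  rw [avg_sum, avg_pseudoDensity_chi]
  refine Finset.sum_subset (fun E hE => ?_) fun E hE hE' => ?_
  · simp only [Finset.mem_filter, Finset.mem_univ, true_and] at hE ⊢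
    exact (Finset.card_le_card Finset.sdiff_subset).trans hE
  · simp only [Finset.mem_filter, Finset.mem_univ, true_and, not_le] at hE hE'
    by_contra h0
    have h1 : E.card ≤ 2 * M := by
      have := Finset.card_le_card_sdiff_add_card (s := E) (t := C)
      omega
    have h2 := hg.degree_gap hp h1 h0
    have h3 : z * E.card ≤ z * M := h2.trans hR
    have h4 : E.card ≤ M := by exact_mod_cast le_of_mul_le_mul_left h3 hz
    omega

/-- The part of the character `chi B` that is visible from `W`, given the constraints
outside `C`. -/
noncomputable def localTrace (g : F → (V → Bool) → ℝ) (M : ℕ) (C : Finset F) (W B : Finset V)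
    (x : V → Bool) : ℝ :=
  ∑ R ∈ W.powerset, avg (fun y => outerDensity g M C y * chi (symmDiff B R) y) * chi R x

lemma avg_outerDensity_chi (M : ℕ) (C : Finset F) (R : Finset V) :
    avg (fun x => outerDensity g M C x * chi R x)
      = ∑ E ∈ Cᶜ.powerset with E.card ≤ M, avg (fun x => centredProd g E x * chi R x) := by
  simp only [outerDensity, Finset.sum_mul]
  rw [avg_sum]

lemma avg_centredProd_empty (R : Finset V) :
    avg (fun x => centredProd g ∅ x * chi R x) = if R = ∅ then 1 else 0 := by
  simpa [centredProd] using avg_chi R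

lemma localTrace_of_subset {M : ℕ} {C : Finset F} {W B : Finset V}
    (hcl : IsClosedAround g M C W) (hB : B ⊆ W) (x : V → Bool) :
    localTrace g M C W B x = chi B x := by
  rw [localTrace, Finset.sum_eq_single_of_mem B (Finset.mem_powerset.mpr hB)]
  all_goals
    have key : ∀ R ⊆ W, avg (fun y => outerDensity g M C y * chi (symmDiff B R) y)
        = if symmDiff B R = ∅ then 1 else 0 := by
      intro R hR
      rw [avg_outerDensity_chi, ← avg_centredProd_empty (g := g)]
      refine Finset.sum_eq_single_of_mem ∅ (by simp) fun E hE hE0 => ?_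
      simp only [Finset.mem_filter, Finset.mem_powerset] at hE
      by_contra h
      have h1 := hcl E (Finset.nonempty_iff_ne_empty.mpr hE0)
        (Finset.disjoint_left.mpr fun f hf => by simpa using hE.1 hf) hE.2 _ h
      have h2 : symmDiff B R \ W = ∅ := by
        refine Finset.sdiff_eq_empty_iff_subset.mpr fun v hv => ?_
        rcases Finset.mem_symmDiff.mp hv with h | h
        exacts [hB h.1, hR h.1]
      simp [h2] at h1
  · rw [key B hB]
    simp
  · intro R hR hne
    rw [key R (Finset.mem_powerset.mp hR), if_neg, zero_mul]
    exact fun h => hne (symmDiff_eq_bot.mp h).symm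

lemma localTrace_mem_span {M : ℕ} {C : Finset F} {W B : Finset V}
    (hcl : IsClosedAround g M C W) (hB : ¬ B ⊆ W) :
    localTrace g M C W B ∈ Submodule.span ℝ (chi '' {R : Finset V | R ⊆ W ∧ R.card < B.card}) := by
  have : localTrace g M C W B = ∑ R ∈ W.powerset,
      avg (fun y => outerDensity g M C y * chi (symmDiff B R) y) • chi R := by
    ext x
    simp [localTrace, Finset.sum_apply]
  rw [this]
  refine Submodule.sum_mem _ fun R hR => ?_
  rw [Finset.mem_powerset] at hR
  by_cases h0 : avg (fun y => outerDensity g M C y * chi (symmDiff B R) y) = 0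
  · simp [h0]
  refine Submodule.smul_mem _ _ (Submodule.subset_span ⟨R, ⟨hR, ?_⟩, rfl⟩)
  rw [avg_outerDensity_chi] at h0
  obtain ⟨E, hE, hne⟩ := Finset.exists_ne_zero_of_sum_ne_zero h0
  simp only [Finset.mem_filter, Finset.mem_powerset] at hE
  have hE0 : E.Nonempty := by
    rw [Finset.nonempty_iff_ne_empty]
    rintro rfl
    rw [avg_centredProd_empty] at hne
    have h : symmDiff B R = ∅ := by
      by_contra h
      simp [h] at hne
    exact hB ((symmDiff_eq_bot.mp h).trans_subset hR)
  have h1 := hcl E hE0 (Finset.disjoint_left.mpr fun f hf => by simpa using hE.1 hf) hE.2 _ hne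
  have h2 : (symmDiff B R \ W).card ≤ (B \ W).card := by
    refine Finset.card_le_card fun v hv => ?_
    simp only [Finset.mem_sdiff, Finset.mem_symmDiff] at hv ⊢
    have := @hR v
    tauto
  have h3 : R.card ≤ (symmDiff B R ∩ W).card + (B ∩ W).card := by
    refine (Finset.card_le_card fun v hv => ?_).trans (Finset.card_union_le _ _)
    simp only [Finset.mem_union, Finset.mem_inter, Finset.mem_symmDiff]
    have := hR hv
    tauto
  have h4 := Finset.card_inter_add_card_sdiff B W
  omega

lemma IsLocalFamily.avg_localDensity_mul_eq (hg : IsLocalFamily N τ g) {z : ℝ} (hz : 0 < z)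
    {M : ℕ} (hp : Plausible N τ z (2 * M)) {C : Finset F} (hC : C.card ≤ M) {W S B : Finset V}
    (hW : C.biUnion N ⊆ W) (hS : S ⊆ W) (hSB : (S.card + B.card : ℝ) ≤ z * M) :
    avg (fun x => chi S x * chi B x * pseudoDensity g M x)
      = avg (fun x => localDensity g C x * (chi S x * localTrace g M C W B x)) := by
  have e1 : ∀ x, chi S x * chi B x * pseudoDensity g M x
      = pseudoDensity g M x * chi (symmDiff S B) x := by
    intro x
    rw [chi_mul_chi]
    ring
  have hcard : ((symmDiff S B).card : ℝ) ≤ z * M := by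
    refine le_trans ?_ hSB
    exact_mod_cast (Finset.card_le_card (Finset.symmDiff_subset_union)).trans
      (Finset.card_union_le _ _)
  simp only [e1]
  rw [hg.avg_pseudoDensity_eq hz hp hC hcard]
  have e2 : ∀ x, localDensity g C x * outerDensity g M C x * chi (symmDiff S B) x
      = ∑ R : Finset V, avg (fun y => outerDensity g M C y * chi (symmDiff B R) y) *
          (localDensity g C x * chi S x * chi R x) := by
    intro x
    have h1 := fourier_inversion (fun y => outerDensity g M C y * chi B y) x
    have h2 : ∀ R : Finset V, avg (fun y => outerDensity g M C y * chi B y * chi R y)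
        = avg (fun y => outerDensity g M C y * chi (symmDiff B R) y) := by
      intro R
      simp only [mul_assoc, chi_mul_chi]
    simp only [h2] at h1
    calc localDensity g C x * outerDensity g M C x * chi (symmDiff S B) x
        = localDensity g C x * chi S x * (outerDensity g M C x * chi B x) := by
          rw [← chi_mul_chi]
          ring
      _ = _ := by
          rw [h1, Finset.mul_sum]
          exact Finset.sum_congr rfl fun R _ => by ring
  have e3 : ∀ x, localDensity g C x * (chi S x * localTrace g M C W B x)
      = ∑ R ∈ W.powerset, avg (fun y => outerDensity g M C y * chi (symmDiff B R) y) *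
          (localDensity g C x * chi S x * chi R x) := by
    intro x
    rw [localTrace, Finset.mul_sum, Finset.mul_sum]
    exact Finset.sum_congr rfl fun R _ => by ring
  simp only [e2, e3]
  rw [avg_sum, avg_sum]
  symm
  refine Finset.sum_subset (Finset.subset_univ _) fun R _ hR => ?_
  rw [avg_const_mul]
  rw [Finset.mem_powerset, Finset.not_subset] at hR
  obtain ⟨i, hi, hiW⟩ := hR
  rw [avg_mul_chi_eq_zero hi, mul_zero]
  intro x
  congr 1
  · refine Finset.prod_congr rfl fun f hf => biUnion_dependence hg f (fun h => hiW ?_) x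
    exact hW (Finset.mem_biUnion.mpr ⟨f, hf, h⟩)
  · refine Finset.prod_congr rfl fun j hj => ?_
    rw [Function.update_of_ne]
    rintro rfl
    exact hiW (hS hj)

lemma IsLocalFamily.avg_pseudoDensity (hg : IsLocalFamily N τ g) {z : ℝ} (hz : 0 < z)
    {M : ℕ} (hp : Plausible N τ z (2 * M)) : avg (pseudoDensity g M) = 1 := by
  have h := avg_pseudoDensity_chi (g := g) M (∅ : Finset V)
  simp only [chi_empty, mul_one] at h
  refine h.trans ?_
  rw [Finset.sum_eq_single_of_mem ∅ (by simp)]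
  · simpa [centredProd] using avg_one (V := V)
  · intro E hE hE0
    by_contra hne
    simp only [Finset.mem_filter, Finset.mem_univ, true_and] at hE
    have h1 := hg.degree_gap (R := ∅) hp (E := E) (by omega) (by simpa [chi_empty] using hne)
    have h2 : 0 < (E.card : ℝ) := by
      exact_mod_cast (Finset.nonempty_iff_ne_empty.mpr hE0).card_pos
    simp only [Finset.card_empty, Nat.cast_zero] at h1
    nlinarith

end Pseudo

section Positivity

variable {V F : Type} [Fintype V] [DecidableEq V] [DecidableEq F] [Fintype F]
variable {N : F → Finset V} {τ : F → ℕ} {g : F → (V → Bool) → ℝ}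

/-- Averaging against the weight `w`, as a linear functional. -/
noncomputable def wavg (w : (V → Bool) → ℝ) : ((V → Bool) → ℝ) →ₗ[ℝ] ℝ where
  toFun f := avg (fun x => w x * f x)
  map_add' f h := by
    simp only [avg, Pi.add_apply, mul_add, Finset.sum_add_distrib, add_div]
  map_smul' a f := by
    simp only [Pi.smul_apply, smul_eq_mul, RingHom.id_apply]
    rw [← avg_const_mul]
    congr 1
    ext x
    ring

lemma wavg_apply (w f : (V → Bool) → ℝ) : wavg w f = avg (fun x => w x * f x) := rfl

lemma wavg_mul_self_nonneg {w : (V → Bool) → ℝ} (hw : ∀ x, 0 ≤ w x) (f : (V → Bool) → ℝ) :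
    0 ≤ wavg w (f * f) :=
  avg_nonneg fun x => mul_nonneg (hw x) (mul_self_nonneg _)

/-- Orthogonal projection for the semi-inner product given by a nonnegative weight. -/
lemma exists_wavg_projection {w : (V → Bool) → ℝ} (hw : ∀ x, 0 ≤ w x)
    (K : Submodule ℝ ((V → Bool) → ℝ)) (a : (V → Bool) → ℝ) :
    ∃ h ∈ K, ∀ u ∈ K, wavg w ((a - h) * u) = 0 := by
  let φ : ((V → Bool) → ℝ) →ₗ[ℝ] EuclideanSpace ℝ (V → Bool) :=
    { toFun := fun f => WithLp.toLp 2 fun x => Real.sqrt (w x) * f x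
      map_add' := fun f h => by ext x; simp [mul_add]
      map_smul' := fun c f => by ext x; simp; ring }
  obtain ⟨h, hK, hh⟩ : ((K.map φ).starProjection (φ a)) ∈ K.map φ :=
    Submodule.starProjection_apply_mem _ _
  refine ⟨h, hK, fun u hu => ?_⟩
  have h0 := (K.map φ).starProjection_inner_eq_zero (φ a) (φ u) (Submodule.mem_map_of_mem hu)
  rw [← hh, ← map_sub, PiLp.inner_apply] at h0
  have e : ∀ x, inner ℝ ((φ (a - h)) x) ((φ u) x) = w x * ((a - h) * u) x := by
    intro x
    simp only [φ, LinearMap.coe_mk, AddHom.coe_mk, Pi.mul_apply, RCLike.inner_apply, conj_trivial]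
    have := Real.mul_self_sqrt (hw x)
    linear_combination (((a - h) x) * u x) * this
  simp only [e] at h0
  rw [wavg_apply, avg, h0, zero_div]

lemma IsLocalFamily.wavg_mul_chi (hg : IsLocalFamily N τ g) {z : ℝ} (hz : 0 < z)
    {M : ℕ} (hp : Plausible N τ z (2 * M)) {C : Finset F} (hC : C.card ≤ M) {W B : Finset V}
    (hW : C.biUnion N ⊆ W) {d : ℕ} (hd : 2 * (d : ℝ) ≤ z * M) (hB : B.card ≤ d)
    {q : (V → Bool) → ℝ}
    (hq : q ∈ Submodule.span ℝ (chi '' {S : Finset V | S ⊆ W ∧ S.card ≤ d})) :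
    wavg (pseudoDensity g M) (q * chi B)
      = wavg (localDensity g C) (q * localTrace g M C W B) := by
  induction hq using Submodule.span_induction with
  | mem q hq =>
    obtain ⟨S, ⟨hS, hSd⟩, rfl⟩ := hq
    have h1 : (S.card : ℝ) ≤ d := by exact_mod_cast hSd
    have h2 : (B.card : ℝ) ≤ d := by exact_mod_cast hB
    have := hg.avg_localDensity_mul_eq hz hp hC hW hS (B := B) (by linarith)
    simp only [wavg_apply, Pi.mul_apply]
    rw [← this]
    congr 1
    ext x
    ring
  | zero => simp
  | add p q _ _ hp hq => rw [add_mul, add_mul, map_add, map_add, hp, hq]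
  | smul a q _ hq => rw [smul_mul_assoc, smul_mul_assoc, map_smul, map_smul, hq]

lemma IsLocalFamily.wavg_mul_chi_of_subset (hg : IsLocalFamily N τ g) {z : ℝ} (hz : 0 < z)
    {M : ℕ} (hp : Plausible N τ z (2 * M)) {C : Finset F} (hC : C.card ≤ M) {W : Finset V}
    (hW : C.biUnion N ⊆ W) (hcl : IsClosedAround g M C W) {d : ℕ} (hd : 2 * (d : ℝ) ≤ z * M)
    {q r : (V → Bool) → ℝ}
    (hq : q ∈ Submodule.span ℝ (chi '' {S : Finset V | S ⊆ W ∧ S.card ≤ d}))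
    (hr : r ∈ Submodule.span ℝ (chi '' {S : Finset V | S ⊆ W ∧ S.card ≤ d})) :
    wavg (pseudoDensity g M) (q * r) = wavg (localDensity g C) (q * r) := by
  induction hr using Submodule.span_induction with
  | mem r hr =>
    obtain ⟨S, ⟨hS, hSd⟩, rfl⟩ := hr
    rw [hg.wavg_mul_chi hz hp hC hW hd hSd hq, funext (localTrace_of_subset hcl hS)]
  | zero => simp
  | add p q _ _ hp hq => rw [mul_add, map_add, map_add, hp, hq]
  | smul a q _ hq => rw [mul_smul_comm, map_smul, map_smul, hq]

/-- Gram–Schmidt step: adding one more character keeps the pseudoexpectation positive. -/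
lemma IsLocalFamily.psd_insert (hg : IsLocalFamily N τ g) {z : ℝ} (hz : 0 < z)
    {M : ℕ} (hp : Plausible N τ z (2 * M)) {A : Finset V} (hd : 2 * (A.card : ℝ) ≤ z * M)
    {s : Set (Finset V)} (hs : ∀ B ∈ s, B.card ≤ A.card)
    (hlow : ∀ B : Finset V, B.card < A.card → B ∈ s)
    (ih : ∀ q ∈ Submodule.span ℝ (chi '' s), 0 ≤ wavg (pseudoDensity g M) (q * q)) :
    ∀ q ∈ Submodule.span ℝ (chi '' insert A s), 0 ≤ wavg (pseudoDensity g M) (q * q) := by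
  obtain ⟨C, hC, hcl⟩ := hg.exists_closure hz hp A hd
  set W := A ∪ C.biUnion N with hWdef
  have hW : C.biUnion N ⊆ W := Finset.subset_union_right
  have hAW : A ⊆ W := Finset.subset_union_left
  have hw : ∀ x, 0 ≤ localDensity g C x := fun x => Finset.prod_nonneg fun f _ => hg.nonneg f x
  set K := Submodule.span ℝ (chi '' {B : Finset V | B ∈ s ∧ B ⊆ W}) with hK
  obtain ⟨h, hhK, hh⟩ := exists_wavg_projection hw K (chi A)
  have hKs : K ≤ Submodule.span ℝ (chi '' s) :=
    Submodule.span_mono (Set.image_mono fun B hB => hB.1)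
  have hKd : K ≤ Submodule.span ℝ (chi '' {S : Finset V | S ⊆ W ∧ S.card ≤ A.card}) :=
    Submodule.span_mono (Set.image_mono fun B hB => ⟨hB.2, hs B hB.1⟩)
  have hAh : chi A - h ∈ Submodule.span ℝ (chi '' {S : Finset V | S ⊆ W ∧ S.card ≤ A.card}) :=
    Submodule.sub_mem _ (Submodule.subset_span ⟨A, ⟨hAW, le_rfl⟩, rfl⟩) (hKd hhK)
  have hortho : ∀ u ∈ Submodule.span ℝ (chi '' s),
      wavg (pseudoDensity g M) ((chi A - h) * u) = 0 := by
    intro u hu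
    induction hu using Submodule.span_induction with
    | mem u hu =>
      obtain ⟨B, hB, rfl⟩ := hu
      rw [hg.wavg_mul_chi hz hp hC hW hd (hs B hB) hAh]
      refine hh _ ?_
      by_cases hBW : B ⊆ W
      · rw [funext (localTrace_of_subset hcl hBW)]
        exact Submodule.subset_span ⟨B, ⟨hB, hBW⟩, rfl⟩
      · refine Submodule.span_mono (Set.image_mono ?_) (localTrace_mem_span hcl hBW)
        exact fun R hR => ⟨hlow R (hR.2.trans_le (hs B hB)), hR.1⟩
    | zero => simp
    | add p q _ _ hp hq => rw [mul_add, map_add, hp, hq, add_zero]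
    | smul a q _ hq => rw [mul_smul_comm, map_smul, hq, smul_zero]
  intro q hq
  rw [Set.image_insert_eq, Submodule.mem_span_insert] at hq
  obtain ⟨a, v, hv, rfl⟩ := hq
  have hu : a • h + v ∈ Submodule.span ℝ (chi '' s) :=
    Submodule.add_mem _ (Submodule.smul_mem _ _ (hKs hhK)) hv
  have e : (a • chi A + v) * (a • chi A + v)
      = (a * a) • ((chi A - h) * (chi A - h)) + (2 * a) • ((chi A - h) * (a • h + v))
        + (a • h + v) * (a • h + v) := by
    ext x
    simp only [Pi.add_apply, Pi.mul_apply, Pi.smul_apply, Pi.sub_apply, smul_eq_mul]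
    ring
  rw [e, map_add, map_add, map_smul, map_smul, hortho _ hu,
    hg.wavg_mul_chi_of_subset hz hp hC hW hcl hd hAh hAh]
  have h1 := wavg_mul_self_nonneg hw (chi A - h)
  have h2 := ih _ hu
  have h3 := mul_self_nonneg a
  simp only [smul_eq_mul, mul_zero, add_zero]
  positivity

/-- The truncated expansion is positive on squares of low-degree functions. -/
lemma IsLocalFamily.psd (hg : IsLocalFamily N τ g) {z : ℝ} (hz : 0 < z)
    {M : ℕ} (hp : Plausible N τ z (2 * M)) (d : ℕ) :
    2 * (d : ℝ) ≤ z * M + 2 →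
    ∀ q ∈ Submodule.span ℝ (chi '' {S : Finset V | S.card < d}),
      0 ≤ wavg (pseudoDensity g M) (q * q) := by
  induction d with
  | zero =>
    intro _ q hq
    simp only [Nat.not_lt_zero, Set.ofPred_false, Set.image_empty, Submodule.span_empty,
      Submodule.mem_bot] at hq
    simp [hq]
  | succ d ih =>
    intro hd
    push_cast at hd
    have key : ∀ s : Finset (Finset V), (∀ B ∈ s, B.card = d) →
        ∀ q ∈ Submodule.span ℝ (chi '' {S : Finset V | S.card < d ∨ S ∈ s}),
          0 ≤ wavg (pseudoDensity g M) (q * q) := by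
      intro s
      induction s using Finset.induction_on with
      | empty => simpa using ih (by linarith)
      | insert A s _ ihs =>
        intro hs
        have hA : A.card = d := hs A (Finset.mem_insert_self A s)
        have hs' : ∀ B ∈ s, B.card = d := fun B hB => hs B (Finset.mem_insert_of_mem hB)
        have := hg.psd_insert hz hp (A := A) (by rw [hA]; linarith)
          (s := {S : Finset V | S.card < d ∨ S ∈ s})
          (by
            rintro B (h | h)
            · omega
            · have := hs' B h
              omega)
          (fun B hB => Or.inl (hA ▸ hB)) (ihs hs')
        have e : {S : Finset V | S.card < d ∨ S ∈ insert A s}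
            = insert A {S : Finset V | S.card < d ∨ S ∈ s} := by
          ext S
          simp only [Set.mem_ofPred_eq, Finset.mem_insert, Set.mem_insert_iff]
          tauto
        rwa [e]
    have := key (Finset.univ.filter fun B => B.card = d) (by simp)
    have e : {S : Finset V | S.card < d + 1}
        = {S : Finset V | S.card < d ∨ S ∈ Finset.univ.filter fun B : Finset V => B.card = d} := by
      ext S
      simp only [Set.mem_ofPred_eq, Finset.mem_filter, Finset.mem_univ, true_and]
      omega
    rwa [e]

lemma mem_span_chi_of_dependsOn {q : (V → Bool) → ℝ} {W : Finset V}
    (hq : ∀ i ∉ W, ∀ x, q (Function.update x i (!x i)) = q x) :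
    q ∈ Submodule.span ℝ (chi '' {S : Finset V | S ⊆ W}) := by
  have : q = ∑ S : Finset V, avg (fun y => q y * chi S y) • chi S := by
    ext x
    simpa [Finset.sum_apply] using fourier_inversion q x
  rw [this]
  refine Submodule.sum_mem _ fun S _ => ?_
  by_cases hS : S ⊆ W
  · exact Submodule.smul_mem _ _ (Submodule.subset_span ⟨S, hS, rfl⟩)
  · obtain ⟨i, hi, hiW⟩ := Finset.not_subset.mp hS
    rw [avg_mul_chi_eq_zero hi (hq i hiW), zero_smul]
    exact Submodule.zero_mem _

/-- Every constraint is satisfied with pseudoprobability one. -/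
lemma IsLocalFamily.wavg_eq_one (hg : IsLocalFamily N τ g) {z : ℝ} (hz : 0 < z)
    {M : ℕ} (hp : Plausible N τ z (2 * M)) (hM : 1 ≤ M) {f : F}
    (hN : 2 * ((N f).card : ℝ) ≤ z * M)
    {q : (V → Bool) → ℝ}
    (hdep : ∀ i ∉ N f, ∀ x, q (Function.update x i (!x i)) = q x)
    (hq : ∀ x, g f x ≠ 0 → q x = 1) :
    wavg (pseudoDensity g M) q = 1 := by
  by_cases hne : g f = 1
  · have : q = 1 := funext fun x => hq x (by simp [hne])
    rw [this, wavg_apply]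
    simpa using hg.avg_pseudoDensity hz hp
  obtain ⟨C, hC, hcl⟩ := hg.exists_closure hz hp (N f) hN
  set W := N f ∪ C.biUnion N with hWdef
  have hW : C.biUnion N ⊆ W := Finset.subset_union_right
  have hNW : N f ⊆ W := Finset.subset_union_left
  have hf : f ∈ C := by
    by_contra hfC
    obtain ⟨T, hT⟩ : ∃ T : Finset V, avg (fun x => centredProd g {f} x * chi T x) ≠ 0 := by
      by_contra! h
      refine hne (funext fun x => ?_)
      have h1 := fourier_inversion (centredProd g {f}) x
      simp only [h, zero_mul, Finset.sum_const_zero] at h1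
      simp only [centredProd, Finset.prod_singleton] at h1
      simpa [sub_eq_zero] using h1
    have h1 := hcl {f} (Finset.singleton_nonempty f) (by simpa using hfC) (by simpa using hM) T hT
    have h2 : T ⊆ N f := by
      simp only [centredProd, Finset.prod_singleton] at hT
      exact (hg.centred_supp hT).1
    rw [Finset.sdiff_eq_empty_iff_subset.mpr (h2.trans hNW)] at h1
    simp at h1
  have hmono : Submodule.span ℝ (chi '' {S : Finset V | S ⊆ N f})
      ≤ Submodule.span ℝ (chi '' {S : Finset V | S ⊆ W ∧ S.card ≤ (N f).card}) :=
    Submodule.span_mono (Set.image_mono fun S hS => ⟨hS.trans hNW, Finset.card_le_card hS⟩)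
  have hone : (1 : (V → Bool) → ℝ) ∈
      Submodule.span ℝ (chi '' {S : Finset V | S ⊆ W ∧ S.card ≤ (N f).card}) :=
    hmono (mem_span_chi_of_dependsOn fun _ _ _ => rfl)
  have h1 := hg.wavg_mul_chi_of_subset hz hp hC hW hcl hN
    (hmono (mem_span_chi_of_dependsOn hdep)) hone
  have h2 := hg.wavg_mul_chi_of_subset hz hp hC hW hcl hN hone hone
  rw [mul_one] at h1 h2
  have h3 : wavg (localDensity g C) q = wavg (localDensity g C) 1 := by
    simp only [wavg_apply]
    congr 1
    ext x
    by_cases hx : g f x = 0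
    · have : localDensity g C x = 0 := Finset.prod_eq_zero hf hx
      simp [this]
    · simp [hq x hx]
  rw [h1, h3, ← h2, wavg_apply]
  simpa using hg.avg_pseudoDensity hz hp

end Positivity

section Construction

/-- The evaluation of a polynomial at the points of the cube. -/
noncomputable def cubeEval {n : ℕ} : MvPolynomial (Fin n) ℝ →ₗ[ℝ] ((Fin n → Bool) → ℝ) where
  toFun p x := MvPolynomial.eval (fun i => if x i then (1 : ℝ) else 0) p
  map_add' p q := by ext x; simp
  map_smul' a p := by ext x; simp

lemma cubeEval_apply {n : ℕ} (p : MvPolynomial (Fin n) ℝ) (x : Fin n → Bool) :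
    cubeEval p x = MvPolynomial.eval (fun i => if x i then (1 : ℝ) else 0) p := rfl

lemma cubeEval_sq {n : ℕ} (p : MvPolynomial (Fin n) ℝ) :
    cubeEval (p ^ 2) = cubeEval p * cubeEval p := by
  ext x
  simp [cubeEval_apply, sq]

lemma cubeEval_mem_span {n : ℕ} (p : MvPolynomial (Fin n) ℝ) :
    cubeEval p ∈ Submodule.span ℝ (chi '' {S : Finset (Fin n) | S.card < p.totalDegree + 1}) := by
  have h : cubeEval p = ∑ m ∈ p.support, cubeEval (MvPolynomial.monomial m (p.coeff m)) := by
    conv_lhs => rw [MvPolynomial.as_sum p]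
    rw [map_sum]
  rw [h]
  refine Submodule.sum_mem _ fun m hm => ?_
  have hcard : m.support.card ≤ p.totalDegree := by
    refine le_trans ?_ (MvPolynomial.le_totalDegree hm)
    rw [Finsupp.sum, Finset.card_eq_sum_ones]
    exact Finset.sum_le_sum fun i hi => Nat.one_le_iff_ne_zero.mpr (Finsupp.mem_support_iff.mp hi)
  refine Submodule.span_mono (Set.image_mono fun S hS => ?_)
    (mem_span_chi_of_dependsOn (W := m.support) ?_)
  · exact Nat.lt_succ_of_le ((Finset.card_le_card hS).trans hcard)
  · intro i hi x
    simp only [cubeEval_apply, MvPolynomial.eval_monomial]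
    congr 1
    refine Finset.prod_congr rfl fun j hj => ?_
    beta_reduce
    rw [Function.update_of_ne]
    rintro rfl
    exact hi hj

/-- A plausible family of local densities has a pseudoexpectation satisfying every constraint. -/
lemma IsLocalFamily.exists_PE01 {n : ℕ} {F : Type} [Fintype F] [DecidableEq F]
    {N : F → Finset (Fin n)} {τ : F → ℕ} {g : F → (Fin n → Bool) → ℝ}
    (hg : IsLocalFamily N τ g) {z : ℝ} (hz : 0 < z) {M : ℕ} (hM : 1 ≤ M)
    (hp : Plausible N τ z (2 * M)) {D : ℕ} (hD : (D : ℝ) ≤ z * M) :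
    ∃ E : PE01 n D, ∀ (f : F) (Q : MvPolynomial (Fin n) ℝ), 2 * ((N f).card : ℝ) ≤ z * M →
      (∀ i ∉ N f, ∀ x, cubeEval Q (Function.update x i (!x i)) = cubeEval Q x) →
      (∀ x, g f x ≠ 0 → cubeEval Q x = 1) → E.satEq Q 1 := by
  refine ⟨⟨(wavg (pseudoDensity g M)).comp cubeEval, ?_, ?_, ?_⟩, ?_⟩
  · have : cubeEval (1 : MvPolynomial (Fin n) ℝ) = 1 := by
      ext x
      simp [cubeEval_apply]
    rw [LinearMap.comp_apply, this, wavg_apply]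
    simpa using hg.avg_pseudoDensity hz hp
  · intro p q hpq
    rw [LinearMap.comp_apply, LinearMap.comp_apply, show cubeEval p = cubeEval q from funext hpq]
  · intro p hdeg
    rw [LinearMap.comp_apply, cubeEval_sq]
    refine hg.psd hz hp (p.totalDegree + 1) ?_ _ (cubeEval_mem_span p)
    have : (2 * p.totalDegree : ℝ) ≤ D := by exact_mod_cast hdeg
    push_cast
    linarith
  · intro f Q hN hdep hQ
    refine ⟨hg.wavg_eq_one hz hp hM hN hdep hQ, ?_⟩
    show wavg (pseudoDensity g M) (cubeEval (Q ^ 2)) = 1 ^ 2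
    rw [cubeEval_sq, one_pow]
    refine hg.wavg_eq_one hz hp hM hN (fun i hi x => ?_) fun x hx => ?_
    · simp [hdep i hi x]
    · simp [hQ x hx]

lemma cubeEval_ind01 {n k : ℕ} (S : Fin k → Fin n) (a : Fin k → Bool) (x : Fin n → Bool) :
    cubeEval (ind01 S a) x = if a = fun i => x (S i) then 1 else 0 := by
  simp only [cubeEval_apply, ind01, map_prod]
  split_ifs with h
  · refine Finset.prod_eq_one fun i _ => ?_
    have := congrFun h i
    cases hx : x (S i) <;> simp_all
  · obtain ⟨i, hi⟩ := Function.ne_iff.mp h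
    refine Finset.prod_eq_zero (Finset.mem_univ i) ?_
    cases hx : x (S i) <;> cases ha : a i <;> simp_all

lemma cubeEval_sum_ind01 {n k : ℕ} (μ : (Fin k → Bool) → ℝ) (S : Fin k → Fin n)
    (x : Fin n → Bool) [Decidable (μ (fun i => x (S i)) ≠ 0)] :
    cubeEval (∑ a ∈ rsupp μ, ind01 S a) x = if μ (fun i => x (S i)) ≠ 0 then 1 else 0 := by
  rw [map_sum, Finset.sum_apply]
  simp only [cubeEval_ind01, rsupp]
  rw [Finset.sum_ite_eq']
  simp

end Construction

section LocalDensities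

variable {V : Type} [Fintype V] [DecidableEq V]

lemma chi_map {k : ℕ} (S : Fin k ↪ V) (I : Finset (Fin k)) (x : V → Bool) :
    chi (I.map S) x = chi I (fun i => x (S i)) := by
  simp [chi]

/-- The uniform measure on a cube projects to the uniform measure on a subcube. -/
lemma avg_comp {k : ℕ} (S : Fin k ↪ V) (G : (Fin k → Bool) → ℝ) :
    avg (fun x : V → Bool => G (fun i => x (S i))) = avg G := by
  have h : ∀ x : V → Bool, G (fun i => x (S i))
      = ∑ I : Finset (Fin k), avg (fun y => G y * chi I y) * chi (I.map S) x := by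
    intro x
    simp only [chi_map]
    exact fourier_inversion G _
  simp only [h]
  rw [avg_sum]
  simp only [avg_const_mul]
  simp only [show ∀ I : Finset (Fin k), avg (fun x => chi (I.map S) x) = if I = ∅ then 1 else 0 by
    intro I; simpa using avg_chi (I.map S)]
  simp [chi_empty]

/-- The density on the whole cube of the constraint that `x_S`, negated by `s`, follows `ν`. -/
noncomputable def scopeDensity {k : ℕ} (ν : (Fin k → Bool) → ℝ) (S : Fin k ↪ V)
    (s : Fin k → Bool) (x : V → Bool) : ℝ :=
  2 ^ k * ν (fun i => Bool.xor (x (S i)) (s i))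

lemma kwiseUniform_fourier {k j : ℕ} {ν : (Fin k → Bool) → ℝ} (hν : kwiseUniform j ν)
    {I : Finset (Fin k)} (hI : I ≠ ∅) (hIj : I.card ≤ j) : ∑ y, ν y * chi I y = 0 := by
  have hind : ∀ a y : Fin k → Bool, ∑ J ∈ I.powerset, chi J a * chi J y
      = if ∀ i ∈ I, y i = a i then (2 : ℝ) ^ I.card else 0 := by
    intro a y
    have h : ∑ J ∈ I.powerset, chi J a * chi J y = ∏ i ∈ I, (1 + bsign (a i) * bsign (y i)) := by
      rw [Finset.prod_one_add]
      simp [chi, Finset.prod_mul_distrib]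
    rw [h]
    split_ifs with hay
    · rw [Finset.prod_congr rfl (g := fun _ => (2 : ℝ)) fun i hi => ?_, Finset.prod_const]
      rw [hay i hi, bsign_mul_self]
      norm_num
    · push Not at hay
      obtain ⟨i, hi, hne⟩ := hay
      refine Finset.prod_eq_zero hi ?_
      revert hne
      cases a i <;> cases y i <;> simp [bsign]
  have hsum : ∀ a : Fin k → Bool,
      ∑ J ∈ I.powerset, (∑ y, ν y * chi J y) * chi J a = 1 := by
    intro a
    have h1 : ∑ y with ∀ i ∈ I, y i = a i, ν y = (1 / 2 : ℝ) ^ I.card := by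
      convert hν I hIj a
    calc ∑ J ∈ I.powerset, (∑ y, ν y * chi J y) * chi J a
        = ∑ y, ν y * ∑ J ∈ I.powerset, chi J a * chi J y := by
          simp only [Finset.sum_mul, Finset.mul_sum]
          rw [Finset.sum_comm]
          exact Finset.sum_congr rfl fun y _ => Finset.sum_congr rfl fun J _ => by ring
      _ = 2 ^ I.card * ∑ y with ∀ i ∈ I, y i = a i, ν y := by
          simp only [hind, mul_ite, mul_zero]
          rw [← Finset.sum_filter, Finset.mul_sum]
          exact Finset.sum_congr rfl fun y _ => mul_comm _ _
      _ = 1 := by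
          rw [h1, ← mul_pow]
          norm_num
  have h2 : avg (fun a => (∑ J ∈ I.powerset, (∑ y, ν y * chi J y) * chi J a) * chi I a)
      = ∑ y, ν y * chi I y := by
    simp only [Finset.sum_mul _ _ (chi I _), mul_assoc]
    rw [avg_sum]
    simp only [avg_const_mul, avg_chi_mul_chi]
    simp
  rw [← h2]
  simp only [hsum, one_mul]
  exact (avg_chi I).trans (if_neg hI)

lemma sum_xor_chi {k : ℕ} (ν : (Fin k → Bool) → ℝ) (s : Fin k → Bool) (I : Finset (Fin k)) :
    ∑ y, ν (fun i => Bool.xor (y i) (s i)) * chi I y = chi I s * ∑ y, ν y * chi I y := by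
  have hinv : Function.Involutive (fun y : Fin k → Bool => fun i => Bool.xor (y i) (s i)) := by
    intro y
    ext i
    simp
  rw [Finset.mul_sum]
  refine Fintype.sum_equiv hinv.toPerm _ _ fun y => ?_
  simp only [Function.Involutive.coe_toPerm, chi, bsign_xor, Finset.prod_mul_distrib]
  have h : (∏ i ∈ I, bsign (s i)) * ∏ i ∈ I, bsign (s i) = 1 := by
    rw [← Finset.prod_mul_distrib]
    exact Finset.prod_eq_one fun i _ => bsign_mul_self _
  linear_combination (-(ν fun i => Bool.xor (y i) (s i)) * ∏ i ∈ I, bsign (y i)) * h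

lemma update_comp_of_notMem {k : ℕ} (S : Fin k ↪ V) {i : V} (hi : i ∉ Finset.univ.map S)
    (x : V → Bool) (b : Bool) :
    (fun j => Function.update x i b (S j)) = fun j => x (S j) := by
  funext j
  rw [Function.update_of_ne]
  rintro rfl
  exact hi (by simp)

lemma avg_scopeDensity_chi {k : ℕ} (ν : (Fin k → Bool) → ℝ) (S : Fin k ↪ V)
    (s : Fin k → Bool) (I : Finset (Fin k)) :
    avg (fun x => scopeDensity ν S s x * chi (I.map S) x) = chi I s * ∑ y, ν y * chi I y := by
  simp only [chi_map, scopeDensity]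
  rw [avg_comp S (fun y => 2 ^ k * ν (fun i => Bool.xor (y i) (s i)) * chi I y), ← sum_xor_chi]
  simp only [avg, mul_assoc, ← Finset.mul_sum, Fintype.card_fin]
  field_simp

lemma scopeDensity_supp {k t : ℕ} {ν : (Fin k → Bool) → ℝ} (hν : kwiseUniform (t - 1) ν)
    (S : Fin k ↪ V) (s : Fin k → Bool) {T : Finset V} (hT : T ≠ ∅)
    (h : avg (fun x => scopeDensity ν S s x * chi T x) ≠ 0) :
    T ⊆ Finset.univ.map S ∧ t ≤ T.card := by
  have hsub : T ⊆ Finset.univ.map S := by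
    by_contra hsub
    obtain ⟨i, hi, hiS⟩ := Finset.not_subset.mp hsub
    refine h (avg_mul_chi_eq_zero hi fun x => ?_)
    have := update_comp_of_notMem S hiS x (!x i)
    simp only [scopeDensity]
    simp only [congrFun this]
  refine ⟨hsub, ?_⟩
  obtain ⟨I, -, rfl⟩ := Finset.subset_map_iff.mp hsub
  rw [avg_scopeDensity_chi] at h
  by_contra hlt
  rw [Finset.card_map] at hlt
  refine right_ne_zero_of_mul h (kwiseUniform_fourier hν ?_ (by omega))
  rintro rfl
  simp at hT

lemma avg_scopeDensity {k : ℕ} {ν : (Fin k → Bool) → ℝ} (hν : IsDist ν) (S : Fin k ↪ V)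
    (s : Fin k → Bool) : avg (scopeDensity ν S s) = 1 := by
  have := avg_scopeDensity_chi ν S s ∅
  simpa [chi_empty, hν.2] using this

/-- The density of the constraint `chi T x = ε` for a sign `ε`. -/
def parityDensity (T : Finset V) (ε : ℝ) (x : V → Bool) : ℝ := 1 + ε * chi T x

lemma avg_parityDensity_chi (T : Finset V) (ε : ℝ) (R : Finset V) :
    avg (fun x => parityDensity T ε x * chi R x)
      = (if R = ∅ then 1 else 0) + ε * if T = R then 1 else 0 := by
  rw [← avg_chi, ← avg_chi_mul_chi, ← avg_const_mul]
  simp only [avg, parityDensity, add_mul, one_mul, Finset.sum_add_distrib, add_div, mul_assoc]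

lemma chi_eq_one_or (T : Finset V) (x : V → Bool) : chi T x = 1 ∨ chi T x = -1 := by
  have h : chi T x * chi T x = 1 := by
    rw [chi_mul_chi, symmDiff_self]
    exact chi_empty x
  exact mul_self_eq_one_iff.mp h

end LocalDensities

section Blocks

variable {V J : Type} [Fintype V] [DecidableEq V] [DecidableEq J]

/-- `P` is a set of representatives of the orbits of the involution `σ`. -/
structure IsBlocking (σ : V → V) (P : Finset V) : Prop where
  invol : Function.Involutive σ
  cover : ∀ v, v ∈ P ∨ σ v ∈ P
  uniq : ∀ v ∈ P, σ v ∈ P → σ v = v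

/-- The block of a variable. -/
def block (σ : V → V) (i : V) : Finset V := {i, σ i}

/-- The union of the blocks met by `Z`. -/
def blockHull (σ : V → V) (Z : Finset V) : Finset V := Z ∪ Z.image σ

variable {σ : V → V} {P : Finset V}

lemma IsBlocking.block_disjoint (h : IsBlocking σ P) {i j : V} (hi : i ∈ P) (hj : j ∈ P)
    (hij : i ≠ j) : Disjoint (block σ i) (block σ j) := by
  rw [Finset.disjoint_left]
  intro v hvi hvj
  simp only [block, Finset.mem_insert, Finset.mem_singleton] at hvi hvj
  rcases hvi with rfl | rfl <;> rcases hvj with h1 | h1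
  · exact hij h1
  · subst h1
    exact hij (h.uniq j hj hi)
  · have := h.uniq i hi (h1 ▸ hj)
    exact hij (this.symm.trans h1)
  · exact hij (h.invol.injective h1)

lemma mem_biUnion_block_of_map (hσ : Function.Involutive σ) {B : Finset V} {v : V}
    (hv : σ v ∈ B.biUnion (block σ)) : v ∈ B.biUnion (block σ) := by
  simp only [Finset.mem_biUnion, block, Finset.mem_insert, Finset.mem_singleton] at hv ⊢
  obtain ⟨i, hi, h | h⟩ := hv
  · exact ⟨i, hi, Or.inr (by rw [← h, hσ v])⟩
  · exact ⟨i, hi, Or.inl (hσ.injective h)⟩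

lemma card_union_biUnion_block (hσ : Function.Involutive σ) (B Z : Finset V) :
    (B.biUnion (block σ) ∪ blockHull σ Z).card + (B.biUnion (block σ)).card
      ≤ 2 * (Z ∪ B.biUnion (block σ)).card := by
  set Y := B.biUnion (block σ) with hY
  have h1 : Y ∪ blockHull σ Z ⊆ (Z ∪ Y) ∪ (Z \ Y).image σ := by
    intro v hv
    simp only [blockHull, Finset.mem_union, Finset.mem_image, Finset.mem_sdiff] at hv ⊢
    rcases hv with hv | hv | ⟨w, hw, rfl⟩
    · exact Or.inl (Or.inr hv)
    · exact Or.inl (Or.inl hv)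
    · by_cases hwY : σ w ∈ Y
      · exact Or.inl (Or.inr hwY)
      · refine Or.inr ⟨w, ⟨hw, fun hw' => hwY ?_⟩, rfl⟩
        rw [hY]
        refine mem_biUnion_block_of_map hσ ?_
        rwa [hσ w]
  have h2 := (Finset.card_le_card h1).trans (Finset.card_union_le _ _)
  have h3 : ((Z \ Y).image σ).card ≤ (Z \ Y).card := Finset.card_image_le
  have h4 := Finset.card_sdiff_add_card Z Y
  omega

/-- Block expansion of the scopes makes the system of scopes and blocks plausible. -/
lemma IsBlocking.plausible (h : IsBlocking σ P) {k t r : ℕ} (ht : 3 ≤ t) (htk : t ≤ k) {ε : ℝ}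
    (hε : 0 < ε) (hε1 : ε ≤ 1) {scope : J → Finset V} (hscope : ∀ j, (scope j).card = k)
    (hexp : ∀ C : Finset J, C.Nonempty → C.card ≤ r →
      (2 * k - t + ε) * (C.card : ℝ) ≤ (blockHull σ (C.biUnion scope)).card) :
    Plausible (Sum.elim scope fun i : {i // i ∈ P} => block σ i)
      (Sum.elim (fun _ => t) fun i : {i // i ∈ P} => (block σ i).card) (ε / (2 * k)) r := by
  intro C hC
  obtain ⟨Cr, Cb, rfl⟩ : ∃ (Cr : Finset J) (Cb : Finset {i // i ∈ P}), C = Cr.disjSum Cb :=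
    ⟨C.toLeft, C.toRight, Finset.toLeft_disjSum_toRight.symm⟩
  rw [Finset.card_disjSum] at hC
  have hU : (Cr.disjSum Cb).biUnion (Sum.elim scope fun i : {i // i ∈ P} => block σ i)
      = Cr.biUnion scope ∪ (Cb.map (Function.Embedding.subtype _)).biUnion (block σ) := by
    ext v
    simp only [Finset.mem_biUnion, Finset.mem_disjSum, Finset.mem_union, Finset.mem_map]
    constructor
    · rintro ⟨_, ⟨j, hj, rfl⟩ | ⟨i, hi, rfl⟩, hv⟩
      · exact Or.inl ⟨j, hj, hv⟩
      · exact Or.inr ⟨_, ⟨i, hi, rfl⟩, hv⟩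
    · rintro (⟨j, hj, hv⟩ | ⟨_, ⟨i, hi, rfl⟩, hv⟩)
      · exact ⟨_, Or.inl ⟨j, hj, rfl⟩, hv⟩
      · exact ⟨_, Or.inr ⟨i, hi, rfl⟩, hv⟩
  have hY : ((Cb.map (Function.Embedding.subtype _)).biUnion (block σ)).card
      = ∑ i ∈ Cb, (block σ i.1).card := by
    rw [Finset.card_biUnion, Finset.sum_map]
    · rfl
    · intro i hi j hj hij
      obtain ⟨i, -, rfl⟩ := Finset.mem_map.mp hi
      obtain ⟨j, -, rfl⟩ := Finset.mem_map.mp hj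
      exact h.block_disjoint i.2 j.2 hij
  have hCb : Cb.card ≤ ∑ i ∈ Cb, (block σ i.1).card := by
    rw [Finset.card_eq_sum_ones]
    exact Finset.sum_le_sum fun i _ => Finset.card_pos.mpr ⟨i, by simp [block]⟩
  have hmain := card_union_biUnion_block h.invol (Cb.map (Function.Embedding.subtype _))
    (Cr.biUnion scope)
  have hZ1 := Finset.card_le_card (Finset.subset_union_left
    (s₁ := (Cb.map (Function.Embedding.subtype _)).biUnion (block σ))
    (s₂ := blockHull σ (Cr.biUnion scope)))
  have hZ2 := Finset.card_le_card (Finset.subset_union_right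
    (s₁ := (Cb.map (Function.Embedding.subtype _)).biUnion (block σ))
    (s₂ := blockHull σ (Cr.biUnion scope)))
  set Z := ((Cb.map (Function.Embedding.subtype _)).biUnion (block σ)
    ∪ blockHull σ (Cr.biUnion scope)).card with hZ
  rw [hU, Finset.sum_disjSum, Finset.sum_disjSum, Finset.card_disjSum]
  simp only [Sum.elim_inl, Sum.elim_inr, hscope, Finset.sum_const, nsmul_eq_mul]
  rw [hY] at hmain hZ1
  have e1 : (2 * k - t + ε) * (Cr.card : ℝ) ≤ Z := by
    rcases Cr.eq_empty_or_nonempty with rfl | hne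
    · simp
    · exact (hexp Cr hne (by omega)).trans (by exact_mod_cast hZ2)
  have e2 : (Cb.card : ℝ) ≤ Z := by exact_mod_cast hCb.trans hZ1
  have e3 : (Z : ℝ) + ∑ i ∈ Cb, ((block σ i.1).card : ℝ) ≤ 2 * ((Cr.biUnion scope ∪
      (Cb.map (Function.Embedding.subtype _)).biUnion (block σ)).card : ℝ) := by
    exact_mod_cast hmain
  have hk : (3 : ℝ) ≤ k := by exact_mod_cast ht.trans htk
  have ht' : (3 : ℝ) ≤ t := by exact_mod_cast ht
  have hz0 : 0 < ε / (2 * k) := by positivity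
  have hz : ε / (2 * k) * (2 * k) = ε := by field_simp
  have htk' : (t : ℝ) ≤ k := by exact_mod_cast htk
  set z := ε / (2 * k) with hzdef
  push_cast
  have hc : (0 : ℝ) ≤ Cr.card := Nat.cast_nonneg _
  have hz1 : z ≤ 1 := by nlinarith
  have e4 : (2 * k - t + z) * (Cr.card : ℝ) ≤ (1 - z) * Z := by
    refine le_trans ?_ (mul_le_mul_of_nonneg_left e1 (by linarith))
    rw [← mul_assoc]
    refine mul_le_mul_of_nonneg_right ?_ hc
    nlinarith
  have e5 : z * (Cb.card : ℝ) ≤ z * Z := mul_le_mul_of_nonneg_left e2 hz0.le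
  nlinarith

/-- The number of small unions of blocks. -/
lemma IsBlocking.card_closed_le (h : IsBlocking σ P) {l : ℝ} (hl : 0 < l) (hl1 : l ≤ 1) (r : ℝ) :
    (((Finset.univ.filter fun Y : Finset V => (∀ v ∈ Y, σ v ∈ Y) ∧ (Y.card : ℝ) ≤ r).card : ℝ))
        * l ^ r
      ≤ (1 + l) ^ (P.filter fun v => σ v = v).card
        * (1 + l ^ 2) ^ (P.filter fun v => σ v ≠ v).card := by
  set 𝒴 := Finset.univ.filter fun Y : Finset V => (∀ v ∈ Y, σ v ∈ Y) ∧ (Y.card : ℝ) ≤ r with h𝒴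
  set P₁ := P.filter fun v => σ v = v with hP₁
  set P₂ := P.filter fun v => σ v ≠ v with hP₂
  have hcard : ∀ Y : Finset V, (∀ v ∈ Y, σ v ∈ Y) →
      Y.card = (Y ∩ P₁).card + 2 * (Y ∩ P₂).card := by
    intro Y hY
    have e : Y = ((Y ∩ P₁) ∪ (Y ∩ P₂)) ∪ (Y ∩ P₂).image σ := by
      ext v
      simp only [Finset.mem_union, Finset.mem_inter, Finset.mem_image, hP₁, hP₂,
        Finset.mem_filter]
      constructor
      · intro hv
        by_cases hvP : v ∈ P
        · by_cases hs : σ v = v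
          · exact Or.inl (Or.inl ⟨hv, hvP, hs⟩)
          · exact Or.inl (Or.inr ⟨hv, hvP, hs⟩)
        · have hσP := (h.cover v).resolve_left hvP
          refine Or.inr ⟨σ v, ⟨hY v hv, hσP, ?_⟩, h.invol v⟩
          intro hs
          rw [h.invol v] at hs
          exact hvP (hs ▸ hσP)
      · rintro ((hv | hv) | ⟨w, hw, rfl⟩)
        exacts [hv.1, hv.1, hY w hw.1]
    have d1 : Disjoint (Y ∩ P₁) (Y ∩ P₂) := by
      rw [Finset.disjoint_left]
      intro v h1 h2
      simp only [Finset.mem_inter, hP₁, hP₂, Finset.mem_filter] at h1 h2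
      exact h2.2.2 h1.2.2
    have d2 : Disjoint ((Y ∩ P₁) ∪ (Y ∩ P₂)) ((Y ∩ P₂).image σ) := by
      rw [Finset.disjoint_left]
      intro v h1 h2
      have hvP : v ∈ P := by
        simp only [Finset.mem_union, Finset.mem_inter, hP₁, hP₂, Finset.mem_filter] at h1
        tauto
      simp only [Finset.mem_image, Finset.mem_inter, hP₂, Finset.mem_filter] at h2
      obtain ⟨w, hw, rfl⟩ := h2
      exact hw.2.2 (h.uniq w hw.2.1 hvP)
    conv_lhs => rw [e]
    rw [Finset.card_union_of_disjoint d2, Finset.card_union_of_disjoint d1,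
      Finset.card_image_of_injective _ h.invol.injective]
    ring
  have hinj : Set.InjOn (fun Y : Finset V => (Y ∩ P₁, Y ∩ P₂)) (𝒴 : Set (Finset V)) := by
    intro Y hY Y' hY' hYY
    simp only [h𝒴, Finset.coe_filter, Finset.mem_univ, true_and, Set.mem_ofPred_eq] at hY hY'
    have hsub : ∀ Y Y' : Finset V, (∀ v ∈ Y, σ v ∈ Y) → (∀ v ∈ Y', σ v ∈ Y') →
        Y ∩ P₁ = Y' ∩ P₁ → Y ∩ P₂ = Y' ∩ P₂ → Y ⊆ Y' := by
      intro Y Y' hY hY' h1 h2 v hv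
      have hP : ∀ w ∈ Y, w ∈ P → w ∈ Y' := by
        intro w hw hwP
        by_cases hs : σ w = w
        · have : w ∈ Y ∩ P₁ := by simp [hP₁, hw, hwP, hs]
          rw [h1] at this
          exact (Finset.mem_inter.mp this).1
        · have : w ∈ Y ∩ P₂ := by simp [hP₂, hw, hwP, hs]
          rw [h2] at this
          exact (Finset.mem_inter.mp this).1
      rcases h.cover v with hvP | hvP
      · exact hP v hv hvP
      · have := hY' _ (hP _ (hY v hv) hvP)
        rwa [h.invol v] at this
    simp only [Prod.mk.injEq] at hYY
    exact Finset.Subset.antisymm (hsub _ _ hY.1 hY'.1 hYY.1 hYY.2)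
      (hsub _ _ hY'.1 hY.1 hYY.1.symm hYY.2.symm)
  have hgen : ∀ (A : Finset V) (y : ℝ), ∑ S ∈ A.powerset, y ^ S.card = (1 + y) ^ A.card := by
    intro A y
    have := Finset.prod_one_add (s := A) (f := fun _ => y)
    simpa using this.symm
  calc (𝒴.card : ℝ) * l ^ r = ∑ _Y ∈ 𝒴, l ^ r := by simp
    _ ≤ ∑ Y ∈ 𝒴, l ^ (Y ∩ P₁).card * (l ^ 2) ^ (Y ∩ P₂).card := by
        refine Finset.sum_le_sum fun Y hY => ?_
        simp only [h𝒴, Finset.mem_filter, Finset.mem_univ, true_and] at hY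
        rw [← pow_mul, ← pow_add, ← hcard Y hY.1, ← Real.rpow_natCast]
        exact Real.rpow_le_rpow_of_exponent_ge hl hl1 hY.2
    _ = ∑ p ∈ 𝒴.image fun Y : Finset V => (Y ∩ P₁, Y ∩ P₂), l ^ p.1.card * (l ^ 2) ^ p.2.card := by
        rw [Finset.sum_image hinj]
    _ ≤ ∑ p ∈ P₁.powerset ×ˢ P₂.powerset, l ^ p.1.card * (l ^ 2) ^ p.2.card := by
        refine Finset.sum_le_sum_of_subset_of_nonneg (fun p hp => ?_) fun p _ _ => by positivity
        obtain ⟨Y, -, rfl⟩ := Finset.mem_image.mp hp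
        simp
    _ = _ := by
        rw [Finset.sum_product, ← hgen, ← hgen, Finset.sum_mul_sum]

end Blocks

section Instance

/-- The involution of the variables fixing the first `U` and matching the others consecutively. -/
def partner {n : ℕ} (U : ℕ) (hU : 2 ∣ (n - U)) (i : Fin n) : Fin n :=
  if h : (i : ℕ) < U then i
  else if h' : ((i : ℕ) - U) % 2 = 0 then ⟨i + 1, by omega⟩
  else ⟨i - 1, by omega⟩

/-- The representatives of the blocks of `partner`. -/
def partnerReps (n U : ℕ) : Finset (Fin n) :=
  Finset.univ.filter fun i => (i : ℕ) < U ∨ ((i : ℕ) - U) % 2 = 0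

lemma partner_val {n U : ℕ} (hU : 2 ∣ (n - U)) (i : Fin n) :
    (partner U hU i : ℕ) =
      if (i : ℕ) < U then (i : ℕ) else if ((i : ℕ) - U) % 2 = 0 then (i : ℕ) + 1 else i - 1 := by
  unfold partner
  split_ifs <;> rfl

lemma isBlocking_partner {n U : ℕ} (hU : 2 ∣ (n - U)) :
    IsBlocking (partner U hU) (partnerReps n U) where
  invol i := by
    ext
    rw [partner_val, partner_val]
    split_ifs <;> omega
  cover i := by
    simp only [partnerReps, partner, Finset.mem_filter, Finset.mem_univ, true_and]
    split_ifs with h1 h2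
    · exact Or.inl (Or.inl h1)
    · exact Or.inl (Or.inr h2)
    · right
      simp only
      omega
  uniq i := by
    simp only [partnerReps, partner, Finset.mem_filter, Finset.mem_univ, true_and]
    intro h
    split_ifs with h1 h2
    · simp
    · simp only
      omega
    · omega

lemma card_partner_fixed_le {n U : ℕ} (hU : 2 ∣ (n - U)) :
    ((partnerReps n U).filter fun v => partner U hU v = v).card ≤ U := by
  have : ((partnerReps n U).filter fun v => partner U hU v = v).card ≤ (Finset.range U).card := by
    refine Finset.card_le_card_of_injOn (fun i => (i : ℕ)) (fun i hi => ?_)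
      Fin.val_injective.injOn
    have hfix := congrArg Fin.val (Finset.mem_filter.mp (Finset.mem_coe.mp hi)).2
    rw [partner_val] at hfix
    refine Finset.mem_coe.mpr (Finset.mem_range.mpr ?_)
    split_ifs at hfix <;> omega
  simpa using this

lemma isLocalFamily_instance {V J : Type} [Fintype V] [DecidableEq V] {k t : ℕ}
    {ν : (Fin k → Bool) → ℝ} (hdist : IsDist ν) (hwise : kwiseUniform (t - 1) ν)
    (ω : J → (Fin k ↪ V) × (Fin k → Bool)) (σ : V → V) (P : Finset V) (κ : V → ℝ)
    (hκ : ∀ i, κ i = 1 ∨ κ i = -1) :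
    IsLocalFamily
      (Sum.elim (fun j => Finset.univ.map (ω j).1) fun i : {i // i ∈ P} => block σ i)
      (Sum.elim (fun _ => t) fun i : {i // i ∈ P} => (block σ i).card)
      (Sum.elim (fun j => scopeDensity ν (ω j).1 (ω j).2)
        fun i : {i // i ∈ P} => parityDensity (block σ i) (κ i)) where
  nonneg := by
    rintro (j | i) x
    · exact mul_nonneg (by positivity) (hdist.1 _)
    · simp only [Sum.elim_inr, parityDensity]
      rcases hκ i with h | h <;> rcases chi_eq_one_or (block σ i) x with h' | h' <;>
        rw [h, h'] <;> norm_num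
  avg_eq_one := by
    rintro (j | i)
    · exact avg_scopeDensity hdist _ _
    · have := avg_parityDensity_chi (block σ i) (κ i) ∅
      simpa [chi_empty, block] using this
  supp := by
    rintro (j | i) T hT h
    · exact scopeDensity_supp hwise _ _ hT h
    · simp only [Sum.elim_inr] at h ⊢
      rw [avg_parityDensity_chi, if_neg hT, zero_add] at h
      have hbT : block σ i = T := by
        by_contra hne
        simp [hne] at h
      simp [hbT]

lemma chi_pair {V : Type} [DecidableEq V] {a b : V} (h : a ≠ b) (x : V → Bool) :
    chi {a, b} x = bsign (x a) * bsign (x b) := by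
  simp [chi, Finset.prod_pair h]

lemma cubeEval_literal {n : ℕ} (c : Bool) (i : Fin n) (x : Fin n → Bool) :
    cubeEval (if c then X i else 1 - X i) x = if x i = c then 1 else 0 := by
  cases c <;> cases h : x i <;> simp [cubeEval_apply, h]

lemma cubeEval_disagree {n : ℕ} (i j : Fin n) (x : Fin n → Bool) :
    cubeEval (X i * (1 - X j) + (1 - X i) * X j) x = if x i = x j then 0 else 1 := by
  cases h : x i <;> cases h' : x j <;> simp [cubeEval_apply, h, h']

lemma eq_of_one_add_bsign_ne_zero {c d : Bool} (h : 1 + bsign c * bsign d ≠ 0) : d = c := by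
  cases c <;> cases d <;> simp_all [bsign]

lemma ne_of_one_sub_bsign_ne_zero {c d : Bool} (h : 1 + -1 * (bsign c * bsign d) ≠ 0) :
    c ≠ d := by
  rintro rfl
  simp [bsign_mul_self] at h

/-- The three families of constraints of the random instance `ω` with planted unary and matching
constraints. -/
def SatisfiesAll {n k m D : ℕ} (ν : (Fin k → Bool) → ℝ) (U : ℕ) (b : Fin n → Bool)
    (ω : Fin m → (Fin k ↪ Fin n) × (Fin k → Bool)) (E : PE01 n D) : Prop :=
  (∀ j : Fin m,
    E.satEq
      (∑ a ∈ rsupp (fun a : Fin k → Bool => ν (fun i => Bool.xor (a i) ((ω j).2 i))),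
        ind01 (fun i => (ω j).1 i) a) 1) ∧
  (∀ i : Fin n, (i : ℕ) < U →
    E.satEq (if b i then MvPolynomial.X i else 1 - MvPolynomial.X i) 1) ∧
  (∀ a a' : Fin n, U ≤ (a : ℕ) → ((a : ℕ) - U) % 2 = 0 → (a' : ℕ) = (a : ℕ) + 1 →
    E.satEq
      (MvPolynomial.X a * (1 - MvPolynomial.X a') + (1 - MvPolynomial.X a) * MvPolynomial.X a') 1)

/-- Expanding instances have a pseudoexpectation of high degree satisfying all constraints. -/
lemma exists_PE01_of_expansion {n k t m U M D : ℕ} (ht : 3 ≤ t) (htk : t ≤ k)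
    {ν : (Fin k → Bool) → ℝ} (hdist : IsDist ν) (hwise : kwiseUniform (t - 1) ν)
    (hU : 2 ∣ (n - U)) (b : Fin n → Bool) (ω : Fin m → (Fin k ↪ Fin n) × (Fin k → Bool))
    {ε : ℝ} (hε : 0 < ε) (hε1 : ε ≤ 1) (hM : 1 ≤ M)
    (hexp : ∀ C : Finset (Fin m), C.Nonempty → C.card ≤ 2 * M →
      (2 * k - t + ε) * (C.card : ℝ) ≤
        (blockHull (partner U hU) (C.biUnion fun j => Finset.univ.map (ω j).1)).card)
    (hD : (D : ℝ) ≤ ε / (2 * k) * M) (hkM : 2 * (k : ℝ) ≤ ε / (2 * k) * M) :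
    ∃ E : PE01 n D, SatisfiesAll ν U b ω E := by
  have hk3 : (3 : ℝ) ≤ k := by exact_mod_cast ht.trans htk
  have hz : 0 < ε / (2 * k) := by positivity
  set σ := partner U hU with hσ
  set κ : Fin n → ℝ := fun i => if (i : ℕ) < U then bsign (b i) else -1 with hκdef
  have hκ : ∀ i, κ i = 1 ∨ κ i = -1 := by
    intro i
    by_cases h : (i : ℕ) < U <;> cases hb : b i <;> simp [hκdef, h, hb, bsign]
  have hfam := isLocalFamily_instance (t := t) hdist hwise ω σ (partnerReps n U) κ hκ
  have hpl := (isBlocking_partner hU).plausible ht htk hε hε1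
    (scope := fun j => Finset.univ.map (ω j).1) (by simp) hexp
  obtain ⟨E, hE⟩ := hfam.exists_PE01 hz hM hpl hD
  have hblock : ∀ i, 2 * ((block σ i).card : ℝ) ≤ ε / (2 * k) * M := by
    intro i
    have : ((block σ i).card : ℝ) ≤ 2 := by exact_mod_cast Finset.card_le_two
    linarith
  refine ⟨E, fun j => ?_, fun i hi => ?_, fun a a' ha hpar ha' => ?_⟩
  · classical
    refine hE (Sum.inl j) _ ?_ ?_ ?_
    · simpa using hkM
    · intro i hi x
      have := update_comp_of_notMem (ω j).1 hi x (!x i)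
      simp only [cubeEval_sum_ind01]
      simp only [congrFun this]
    · intro x hx
      simp only [cubeEval_sum_ind01]
      exact if_pos (right_ne_zero_of_mul hx)
  · have hiP : i ∈ partnerReps n U := by simp [partnerReps, hi]
    have hσi : σ i = i := by simp [hσ, partner, hi]
    refine hE (Sum.inr ⟨i, hiP⟩) _ (hblock i) ?_ ?_
    · intro v hv x
      have hvi : i ≠ v := by
        rintro rfl
        simp [block] at hv
      rw [cubeEval_literal, cubeEval_literal, Function.update_of_ne hvi]
    · intro x hx
      simp only [Sum.elim_inr, parityDensity, block, hσi, Finset.pair_eq_singleton, chi,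
        Finset.prod_singleton, hκdef, if_pos hi] at hx
      rw [cubeEval_literal, if_pos (eq_of_one_add_bsign_ne_zero hx)]
  · have haP : a ∈ partnerReps n U := by simp [partnerReps, hpar]
    have hσa : σ a = a' := by
      ext
      simp [hσ, partner, not_lt.mpr ha, hpar, ha']
    have hne : a ≠ a' := by
      intro h
      rw [← h] at ha'
      omega
    refine hE (Sum.inr ⟨a, haP⟩) _ (hblock a) ?_ ?_
    · intro v hv x
      simp only [Sum.elim_inr, block, hσa, Finset.mem_insert, Finset.mem_singleton, not_or] at hv
      rw [cubeEval_disagree, cubeEval_disagree, Function.update_of_ne (Ne.symm hv.1),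
        Function.update_of_ne (Ne.symm hv.2)]
    · intro x hx
      simp only [Sum.elim_inr, parityDensity, block, hσa, chi_pair hne, hκdef,
        if_neg (not_lt.mpr ha)] at hx
      rw [cubeEval_disagree, if_neg (ne_of_one_sub_bsign_ne_zero hx)]

/-- Evaluation at a point of the cube. -/
noncomputable def pointPE01 {n : ℕ} (D : ℕ) (x : Fin n → Bool) : PE01 n D where
  pE := (LinearMap.proj x).comp cubeEval
  normalized := by simp [cubeEval_apply]
  multilin p q h := h x
  psd p _ := by
    simp only [LinearMap.comp_apply, LinearMap.proj_apply, cubeEval_sq, Pi.mul_apply]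
    exact mul_self_nonneg _

lemma pointPE01_satEq {n D : ℕ} {x : Fin n → Bool} {Q : MvPolynomial (Fin n) ℝ}
    (h : cubeEval Q x = 1) : (pointPE01 D x).satEq Q 1 := by
  refine ⟨h, ?_⟩
  show cubeEval (Q ^ 2) x = 1 ^ 2
  simp [cubeEval_sq, h]

/-- If `ν` has full support, the constraints can be satisfied by a point. -/
lemma exists_PE01_of_full_support {n k m U D : ℕ} {ν : (Fin k → Bool) → ℝ} (b : Fin n → Bool)
    (ω : Fin m → (Fin k ↪ Fin n) × (Fin k → Bool)) (hν : Fin m → ∀ y, ν y ≠ 0) :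
    ∃ E : PE01 n D, SatisfiesAll ν U b ω E := by
  classical
  let x : Fin n → Bool := fun i =>
    if (i : ℕ) < U then b i else decide (((i : ℕ) - U) % 2 = 0)
  refine ⟨pointPE01 D x, fun j => pointPE01_satEq ?_, fun i hi => pointPE01_satEq ?_,
    fun a a' ha hpar ha' => pointPE01_satEq ?_⟩
  · rw [cubeEval_sum_ind01]
    exact if_pos (hν j _)
  · have hx : x i = b i := by simp [x, hi]
    rw [cubeEval_literal, if_pos hx]
  · have hxa : x a = true := by simp [x, not_lt.mpr ha, hpar]
    have hxa' : x a' = false := by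
      have h1 : ¬ (a' : ℕ) < U := by omega
      have h2 : ¬ ((a' : ℕ) - U) % 2 = 0 := by omega
      simp only [x, if_neg h1, h2, decide_false]
    simp [cubeEval_apply, hxa, hxa']

lemma ne_zero_of_kwiseUniform {k j : ℕ} {ν : (Fin k → Bool) → ℝ} (hν : kwiseUniform j ν)
    (hkj : k ≤ j) (y : Fin k → Bool) : ν y ≠ 0 := by
  have h : ∑ x ∈ {y}, ν x = (1 / 2 : ℝ) ^ (Finset.univ : Finset (Fin k)).card := by
    convert hν Finset.univ (by simpa using hkj) y using 2
    ext x
    simp [funext_iff]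
  rw [Finset.sum_singleton] at h
  rw [h]
  positivity

end Instance

section Counting

lemma half_pow_le_descFactorial {n k : ℕ} (hn : 2 * k ≤ n) :
    ((n : ℝ) / 2) ^ k ≤ (n.descFactorial k : ℝ) := by
  have h1 : ((n + 1 - k : ℕ) : ℝ) ^ k ≤ (n.descFactorial k : ℝ) := by
    exact_mod_cast Nat.pow_sub_le_descFactorial n k
  refine le_trans (pow_le_pow_left₀ (by positivity) ?_ k) h1
  have h2 : (n : ℝ) ≤ ((2 * (n + 1 - k) : ℕ) : ℝ) := by
    exact_mod_cast (by omega)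
  push_cast at h2
  linarith

lemma card_embedding_subset_le {n k : ℕ} (hk : 2 * k ≤ n) (hn : 0 < n) (Y : Finset (Fin n)) :
    ((Finset.univ.filter fun e : (Fin k ↪ Fin n) × (Fin k → Bool) =>
        Finset.univ.map e.1 ⊆ Y).card : ℝ)
      ≤ (2 * Y.card / n) ^ k * Fintype.card ((Fin k ↪ Fin n) × (Fin k → Bool)) := by
  have h1 : (Finset.univ.filter fun e : (Fin k ↪ Fin n) × (Fin k → Bool) =>
        Finset.univ.map e.1 ⊆ Y).card
      ≤ ((Fintype.piFinset fun _ : Fin k => Y) ×ˢ (Finset.univ : Finset (Fin k → Bool))).card := by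
    refine Finset.card_le_card_of_injOn (fun e => (⇑e.1, e.2)) (fun e he => ?_) ?_
    · have := (Finset.mem_filter.mp (Finset.mem_coe.mp he)).2
      refine Finset.mem_coe.mpr (Finset.mem_product.mpr ⟨?_, Finset.mem_univ _⟩)
      rw [Fintype.mem_piFinset]
      exact fun i => this (Finset.mem_map_of_mem _ (Finset.mem_univ i))
    · rintro ⟨e, z⟩ - ⟨e', z'⟩ - h
      simp only [Prod.mk.injEq, DFunLike.coe_fn_eq] at h
      exact Prod.ext h.1 h.2
  rw [Finset.card_product, Fintype.card_piFinset, Finset.prod_const, Finset.card_univ,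
    Finset.card_univ, Fintype.card_fin] at h1
  have hn' : (0 : ℝ) < n := by exact_mod_cast hn
  rw [Fintype.card_prod, Fintype.card_embedding_eq, Fintype.card_fin, Fintype.card_fin]
  push_cast
  calc _ ≤ ((Y.card : ℝ) ^ k * Fintype.card (Fin k → Bool)) := by exact_mod_cast h1
    _ = (2 * Y.card / n) ^ k * ((n / 2) ^ k * Fintype.card (Fin k → Bool)) := by
        rw [← mul_assoc, ← mul_pow]
        congr 2
        field_simp
    _ ≤ _ := by
        gcongr
        exact half_pow_le_descFactorial hk

/-- The number of functions whose values on `C` lie in `A`. -/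
lemma card_forall_mem_le {J X : Type} [Fintype J] [DecidableEq J] [Fintype X] [DecidableEq X]
    (C : Finset J) (A : Finset X) {p : ℝ} (hA : (A.card : ℝ) ≤ p * Fintype.card X) :
    ((Finset.univ.filter fun ω : J → X => ∀ j ∈ C, ω j ∈ A).card : ℝ)
      ≤ p ^ C.card * Fintype.card (J → X) := by
  have h1 : (Finset.univ.filter fun ω : J → X => ∀ j ∈ C, ω j ∈ A)
      = Fintype.piFinset fun j => if j ∈ C then A else Finset.univ := by
    ext ω
    simp only [Finset.mem_filter, Finset.mem_univ, true_and, Fintype.mem_piFinset]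
    refine forall_congr' fun j => ?_
    by_cases hj : j ∈ C <;> simp [hj]
  have h2 : p ^ C.card = ∏ j : J, if j ∈ C then p else 1 := by
    rw [Finset.prod_ite_mem, Finset.univ_inter, Finset.prod_const]
  rw [h1, Fintype.card_piFinset, Fintype.card_fun, ← Finset.card_univ (α := J), h2]
  push_cast
  rw [← Finset.prod_const, ← Finset.prod_mul_distrib]
  refine Finset.prod_le_prod (fun j _ => by positivity) fun j _ => ?_
  by_cases hj : j ∈ C <;> simp [hj, hA, Finset.card_univ]

lemma mem_blockHull_of_mem {V : Type} [DecidableEq V] {σ : V → V} (hσ : Function.Involutive σ)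
    {Z : Finset V} {v : V} (hv : v ∈ blockHull σ Z) : σ v ∈ blockHull σ Z := by
  simp only [blockHull, Finset.mem_union, Finset.mem_image] at hv ⊢
  rcases hv with hv | ⟨w, hw, rfl⟩
  · exact Or.inr ⟨v, hv, rfl⟩
  · exact Or.inl (by rwa [hσ w])

/-- Number of instances in which some `s` scopes have a hull of size at most `r`. -/
lemma card_not_expanding_le {n k m : ℕ} (hk : 2 * k ≤ n) (hn : 0 < n) {σ : Fin n → Fin n}
    (hσ : Function.Involutive σ) (s : ℕ) (r : ℝ) :
    ((Finset.univ.filter fun ω : Fin m → (Fin k ↪ Fin n) × (Fin k → Bool) =>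
        ∃ C : Finset (Fin m), C.card = s ∧
          ((blockHull σ (C.biUnion fun j => Finset.univ.map (ω j).1)).card : ℝ) ≤ r).card : ℝ)
      ≤ m.choose s
        * ((Finset.univ.filter fun Y : Finset (Fin n) =>
            (∀ v ∈ Y, σ v ∈ Y) ∧ (Y.card : ℝ) ≤ r).card : ℝ)
        * ((2 * r / n) ^ k) ^ s
        * Fintype.card (Fin m → (Fin k ↪ Fin n) × (Fin k → Bool)) := by
  set 𝒴 := Finset.univ.filter fun Y : Finset (Fin n) => (∀ v ∈ Y, σ v ∈ Y) ∧ (Y.card : ℝ) ≤ r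
  set 𝒞 := (Finset.univ : Finset (Fin m)).powersetCard s
  let good : Finset (Fin n) → Finset ((Fin k ↪ Fin n) × (Fin k → Bool)) := fun Y =>
    Finset.univ.filter fun e => Finset.univ.map e.1 ⊆ Y
  let F : Finset (Fin m) × Finset (Fin n) →
      Finset (Fin m → (Fin k ↪ Fin n) × (Fin k → Bool)) := fun p =>
    Finset.univ.filter fun ω => ∀ j ∈ p.1, ω j ∈ good p.2
  have hsub : (Finset.univ.filter fun ω : Fin m → (Fin k ↪ Fin n) × (Fin k → Bool) =>
        ∃ C : Finset (Fin m), C.card = s ∧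
          ((blockHull σ (C.biUnion fun j => Finset.univ.map (ω j).1)).card : ℝ) ≤ r)
      ⊆ (𝒞 ×ˢ 𝒴).biUnion F := by
    intro ω hω
    obtain ⟨C, hC, hCr⟩ := (Finset.mem_filter.mp hω).2
    refine Finset.mem_biUnion.mpr
      ⟨(C, blockHull σ (C.biUnion fun j => Finset.univ.map (ω j).1)), ?_, ?_⟩
    · refine Finset.mem_product.mpr ⟨Finset.mem_powersetCard.mpr ⟨Finset.subset_univ _, hC⟩, ?_⟩
      exact Finset.mem_filter.mpr
        ⟨Finset.mem_univ _, fun v hv => mem_blockHull_of_mem hσ hv, hCr⟩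
    · refine Finset.mem_filter.mpr ⟨Finset.mem_univ _, fun j hj => ?_⟩
      refine Finset.mem_filter.mpr ⟨Finset.mem_univ _, ?_⟩
      exact (Finset.subset_biUnion_of_mem (fun j => Finset.univ.map (ω j).1) hj).trans
        Finset.subset_union_left
  have hF : ∀ p ∈ 𝒞 ×ˢ 𝒴, ((F p).card : ℝ) ≤ ((2 * r / n) ^ k) ^ s
      * Fintype.card (Fin m → (Fin k ↪ Fin n) × (Fin k → Bool)) := by
    rintro ⟨C, Y⟩ hp
    obtain ⟨hC, hY⟩ := Finset.mem_product.mp hp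
    rw [← (Finset.mem_powersetCard.mp hC).2]
    refine le_of_eq_of_le ?_ (card_forall_mem_le (p := (2 * r / n) ^ k) C (good Y)
      ((card_embedding_subset_le hk hn Y).trans ?_))
    · simp only [F]
      congr!
    have : (Y.card : ℝ) ≤ r := (Finset.mem_filter.mp hY).2.2
    gcongr
  calc _ ≤ (((𝒞 ×ˢ 𝒴).biUnion F).card : ℝ) := by exact_mod_cast Finset.card_le_card hsub
    _ ≤ ∑ p ∈ 𝒞 ×ˢ 𝒴, ((F p).card : ℝ) := by exact_mod_cast Finset.card_biUnion_le
    _ ≤ _ := Finset.sum_le_card_nsmul _ _ _ hF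
    _ = _ := by
      rw [nsmul_eq_mul, Finset.card_product, Finset.card_powersetCard, Finset.card_univ,
        Fintype.card_fin]
      push_cast
      ring

end Counting

section Estimates

lemma choose_le_exp_mul_div_pow (m : ℕ) {s : ℕ} (hs : 0 < s) :
    (m.choose s : ℝ) ≤ (Real.exp 1 * m / s) ^ s := by
  have hs' : (0 : ℝ) < s := by exact_mod_cast hs
  have h1 : (m.choose s : ℝ) ≤ (m : ℝ) ^ s / s.factorial := Nat.choose_le_pow_div s m
  have h2 := Real.pow_div_factorial_le_exp (s : ℝ) hs'.le s
  have hf : (0 : ℝ) < s.factorial := by exact_mod_cast s.factorial_pos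
  calc (m.choose s : ℝ) ≤ (m : ℝ) ^ s / s.factorial := h1
    _ = (m / s : ℝ) ^ s * ((s : ℝ) ^ s / s.factorial) := by
        rw [div_pow]
        field_simp
    _ ≤ (m / s : ℝ) ^ s * Real.exp s := by gcongr
    _ = (Real.exp 1 * m / s) ^ s := by
        rw [← Real.exp_one_pow, ← mul_pow]
        congr 1
        ring

lemma one_add_pow_le_exp {x : ℝ} (hx : 0 ≤ x) {j : ℕ} {y : ℝ} (hy : x * j ≤ y) :
    (1 + x) ^ j ≤ Real.exp y := by
  calc (1 + x) ^ j ≤ Real.exp x ^ j := by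
        gcongr
        linarith [Real.add_one_le_exp x]
    _ = Real.exp (x * j) := by rw [mul_comm, Real.exp_nat_mul]
    _ ≤ Real.exp y := Real.exp_le_exp.mpr hy

/-- Number of small sets that are unions of blocks of `partner`. -/
lemma card_partner_closed_le {n U s : ℕ} (hU : 2 ∣ (n - U)) {Cu : ℝ}
    (hUn : (U : ℝ) ≤ Cu * √n) (hs : 0 < s) (hsn : s ≤ n) (r : ℝ) :
    ((Finset.univ.filter fun Y : Finset (Fin n) =>
        (∀ v ∈ Y, partner U hU v ∈ Y) ∧ (Y.card : ℝ) ≤ r).card : ℝ)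
      ≤ ((s : ℝ) / n) ^ (-(r / 2)) * Real.exp ((1 + Cu) * s) := by
  have hs' : (1 : ℝ) ≤ s := by exact_mod_cast hs
  have hsn' : (s : ℝ) ≤ n := by exact_mod_cast hsn
  have hn' : (0 : ℝ) < n := by linarith
  have hq : 0 < (s : ℝ) / n := by positivity
  have hq1 : (s : ℝ) / n ≤ 1 := (div_le_one hn').mpr hsn'
  have hCu : 0 ≤ Cu := by
    by_contra hneg
    have : Cu * √n < 0 := mul_neg_of_neg_of_pos (not_le.mp hneg) (Real.sqrt_pos.mpr hn')
    linarith [(Nat.cast_nonneg U : (0 : ℝ) ≤ U)]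
  set l := √((s : ℝ) / n) with hl
  have hl0 : 0 < l := Real.sqrt_pos.mpr hq
  have hl1 : l ≤ 1 := Real.sqrt_le_one.mpr hq1
  have hmain := (isBlocking_partner hU).card_closed_le hl0 hl1 r
  have hlr : l ^ r = ((s : ℝ) / n) ^ (r / 2) := by
    rw [hl, Real.sqrt_eq_rpow, ← Real.rpow_mul hq.le]
    congr 1
    ring
  have hfix : (1 + l) ^ ((partnerReps n U).filter fun v => partner U hU v = v).card
      ≤ Real.exp (Cu * s) := by
    refine one_add_pow_le_exp hl0.le ?_
    calc l * _ ≤ l * U := by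
          gcongr
          exact_mod_cast card_partner_fixed_le hU
      _ ≤ l * (Cu * √n) := by gcongr
      _ = Cu * √s := by
          rw [hl, Real.sqrt_div (by positivity)]
          field_simp
      _ ≤ Cu * s := by
          gcongr
          exact (Real.sqrt_le_left (by positivity)).mpr (by nlinarith)
  have hfree : (1 + l ^ 2) ^ ((partnerReps n U).filter fun v => partner U hU v ≠ v).card
      ≤ Real.exp s := by
    refine one_add_pow_le_exp (by positivity) ?_
    rw [hl, Real.sq_sqrt hq.le]
    calc (s : ℝ) / n * _ ≤ (s : ℝ) / n * n := by
          gcongr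
          exact (Finset.card_le_univ _).trans (Fintype.card_fin n).le
      _ = s := by field_simp
  rw [hlr] at hmain
  have hq2 : 0 < ((s : ℝ) / n) ^ (r / 2) := Real.rpow_pos_of_pos hq _
  rw [Real.rpow_neg hq.le, inv_mul_eq_div, le_div_iff₀ hq2]
  refine le_of_eq_of_le (by congr!)
    (hmain.trans ((mul_le_mul hfix hfree (by positivity) (by positivity)).trans_eq ?_))
  rw [← Real.exp_add]
  congr 1
  ring

/-- Probability that some `s` scopes violate expansion. -/
lemma expansion_failure_term_le {n U s k t Δ : ℕ} (hU : 2 ∣ (n - U)) {Cu ε : ℝ}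
    (hUn : (U : ℝ) ≤ Cu * √n) (hs : 0 < s) (hsn : s ≤ n) (hε : 0 ≤ ε) (hεt : ε ≤ t)
    (htk : t ≤ k) :
    ((Δ * n).choose s : ℝ)
      * ((Finset.univ.filter fun Y : Finset (Fin n) =>
          (∀ v ∈ Y, partner U hU v ∈ Y) ∧ (Y.card : ℝ) ≤ (2 * k - t + ε) * s).card : ℝ)
      * ((2 * ((2 * k - t + ε) * s) / n) ^ k) ^ s
      ≤ (Real.exp (2 + Cu) * (4 * k) ^ k * Δ
          * ((s : ℝ) / n) ^ ((t : ℝ) / 2 - 1 - ε / 2)) ^ s := by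
  have hs' : (1 : ℝ) ≤ s := by exact_mod_cast hs
  have hsn' : (s : ℝ) ≤ n := by exact_mod_cast hsn
  have htk' : (t : ℝ) ≤ k := by exact_mod_cast htk
  have hk0 : (0 : ℝ) ≤ k := Nat.cast_nonneg k
  have hn' : (0 : ℝ) < n := by linarith
  set q := (s : ℝ) / n with hqdef
  have hq : 0 < q := by positivity
  set a : ℝ := 2 * k - t + ε with ha
  have ha0 : 0 ≤ a := by linarith
  have h1 := choose_le_exp_mul_div_pow (Δ * n) hs
  have h2 := card_partner_closed_le hU hUn hs hsn (a * s)
  have h3 : ((2 * (a * s) / n) ^ k) ^ s ≤ ((4 * k * q) ^ k) ^ s := by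
    have : 2 * (a * s) / n = 2 * a * q := by rw [hqdef]; ring
    rw [this]
    have h2a : 2 * a * q ≤ 4 * k * q := mul_le_mul_of_nonneg_right (by linarith) hq.le
    gcongr
  refine (mul_le_mul (mul_le_mul h1 h2 (by positivity) (by positivity)) h3 (by positivity)
    (by positivity)).trans_eq ?_
  have e1 : q ^ (-(a * s / 2)) = (q ^ (-(a / 2))) ^ s := by
    rw [← Real.rpow_mul_natCast hq.le]
    congr 1
    ring
  have e2 : Real.exp ((1 + Cu) * s) = Real.exp (1 + Cu) ^ s := by
    rw [mul_comm, Real.exp_nat_mul]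
  have e3 : q ^ ((t : ℝ) / 2 - 1 - ε / 2) = q⁻¹ * q ^ (-(a / 2)) * q ^ k := by
    rw [← Real.rpow_natCast q k, ← Real.rpow_neg_one q, ← Real.rpow_add hq, ← Real.rpow_add hq]
    congr 1
    rw [ha]
    ring
  have e4 : Real.exp 1 * ((Δ * n : ℕ) : ℝ) / s = Real.exp 1 * Δ * q⁻¹ := by
    rw [hqdef]
    push_cast
    field_simp
  have e5 : Real.exp (2 + Cu) = Real.exp 1 * Real.exp (1 + Cu) := by
    rw [← Real.exp_add]
    congr 1
    ring
  rw [← hqdef, e1, e2, e3, e4, e5, ← mul_pow, ← mul_pow, ← mul_pow, mul_pow (4 * (k : ℝ)) q k]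
  congr 1
  ring

lemma sum_succ_mul_half_pow_le (N : ℕ) :
    ∑ s ∈ Finset.range N, ((s : ℝ) + 1) * (1 / 2) ^ s ≤ 4 := by
  have h : ∑ s ∈ Finset.range N, ((s : ℝ) + 1) * (1 / 2) ^ s = 4 - (2 * N + 4) * (1 / 2) ^ N := by
    induction N with
    | zero => norm_num
    | succ N ih =>
      rw [Finset.sum_range_succ, ih, pow_succ]
      push_cast
      ring
  rw [h]
  have : (0 : ℝ) ≤ (2 * N + 4) * (1 / 2) ^ N := by positivity
  linarith

lemma pow_le_of_base_le_half {A q θ : ℝ} {s n : ℕ} (hA : 0 ≤ A) (hs : 0 < s) (hsn : s ≤ n)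
    (hq : q = (s : ℝ) / n) (hθ : 1 / 4 ≤ θ) (hhalf : A * q ^ θ ≤ 1 / 2) :
    (A * q ^ θ) ^ s ≤ A * (n : ℝ) ^ (-(1 / 4) : ℝ) * (s * (1 / 2) ^ (s - 1)) := by
  have hs' : (1 : ℝ) ≤ s := by exact_mod_cast hs
  have hsn' : (s : ℝ) ≤ n := by exact_mod_cast hsn
  have hn' : (0 : ℝ) < n := by linarith
  have hq0 : 0 < q := by rw [hq]; positivity
  have hq1 : q ≤ 1 := by rw [hq]; exact (div_le_one hn').mpr hsn'
  have h1 : q ^ θ ≤ s * (n : ℝ) ^ (-(1 / 4) : ℝ) := by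
    calc q ^ θ ≤ q ^ (1 / 4 : ℝ) := Real.rpow_le_rpow_of_exponent_ge hq0 hq1 hθ
      _ = (s : ℝ) ^ (1 / 4 : ℝ) * (n : ℝ) ^ (-(1 / 4) : ℝ) := by
          rw [hq, Real.div_rpow (by positivity) hn'.le, Real.rpow_neg hn'.le, div_eq_mul_inv]
      _ ≤ s * (n : ℝ) ^ (-(1 / 4) : ℝ) := by
          gcongr
          calc (s : ℝ) ^ (1 / 4 : ℝ) ≤ (s : ℝ) ^ (1 : ℝ) :=
                Real.rpow_le_rpow_of_exponent_le hs' (by norm_num)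
            _ = s := Real.rpow_one _
  obtain ⟨r, rfl⟩ : ∃ r, s = r + 1 := ⟨s - 1, by omega⟩
  have h0 : 0 ≤ A * q ^ θ := mul_nonneg hA (Real.rpow_nonneg hq0.le _)
  rw [pow_succ, Nat.add_sub_cancel]
  calc (A * q ^ θ) ^ r * (A * q ^ θ)
      ≤ (1 / 2) ^ r * (A * (((r + 1 : ℕ) : ℝ) * (n : ℝ) ^ (-(1 / 4) : ℝ))) := by
        gcongr
    _ = _ := by ring

end Estimates

section Probability

/-- The fraction of instances that do not expand is small. -/
lemma card_not_expander_le {n k t Δ U M : ℕ} (hk : 2 * k ≤ n) (hn : 0 < n) (hU : 2 ∣ (n - U))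
    {Cu ε : ℝ} (hUn : (U : ℝ) ≤ Cu * √n) (hε : 0 ≤ ε) (htk : t ≤ k) (hεt : ε ≤ t)
    (hMn : 2 * M ≤ n) (hθ : 1 / 4 ≤ (t : ℝ) / 2 - 1 - ε / 2)
    (hhalf : ∀ s : ℕ, 0 < s → s ≤ 2 * M →
      Real.exp (2 + Cu) * (4 * k) ^ k * Δ * ((s : ℝ) / n) ^ ((t : ℝ) / 2 - 1 - ε / 2) ≤ 1 / 2) :
    ((Finset.univ.filter fun ω : Fin (Δ * n) → (Fin k ↪ Fin n) × (Fin k → Bool) =>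
        ∃ C : Finset (Fin (Δ * n)), C.Nonempty ∧ C.card ≤ 2 * M ∧
          ((blockHull (partner U hU) (C.biUnion fun j => Finset.univ.map (ω j).1)).card : ℝ)
            ≤ (2 * k - t + ε) * C.card).card : ℝ)
      ≤ 4 * (Real.exp (2 + Cu) * (4 * k) ^ k * Δ) * (n : ℝ) ^ (-(1 / 4) : ℝ)
        * Fintype.card (Fin (Δ * n) → (Fin k ↪ Fin n) × (Fin k → Bool)) := by
  set A := Real.exp (2 + Cu) * (4 * k) ^ k * Δ with hA
  have hA0 : 0 ≤ A := by positivity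
  set W : ℝ := (Fintype.card (Fin (Δ * n) → (Fin k ↪ Fin n) × (Fin k → Bool)) : ℝ)
  let F : ℕ → Finset (Fin (Δ * n) → (Fin k ↪ Fin n) × (Fin k → Bool)) := fun s =>
    Finset.univ.filter fun ω => ∃ C : Finset (Fin (Δ * n)), C.card = s + 1 ∧
      ((blockHull (partner U hU) (C.biUnion fun j => Finset.univ.map (ω j).1)).card : ℝ)
        ≤ (2 * k - t + ε) * ((s + 1 : ℕ) : ℝ)
  have hsub : (Finset.univ.filter fun ω : Fin (Δ * n) → (Fin k ↪ Fin n) × (Fin k → Bool) =>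
        ∃ C : Finset (Fin (Δ * n)), C.Nonempty ∧ C.card ≤ 2 * M ∧
          ((blockHull (partner U hU) (C.biUnion fun j => Finset.univ.map (ω j).1)).card : ℝ)
            ≤ (2 * k - t + ε) * C.card)
      ⊆ (Finset.range (2 * M)).biUnion F := by
    intro ω hω
    obtain ⟨C, hC, hCM, hCr⟩ := (Finset.mem_filter.mp hω).2
    have hpos := hC.card_pos
    have hcard : C.card = C.card - 1 + 1 := by omega
    refine Finset.mem_biUnion.mpr ⟨C.card - 1, Finset.mem_range.mpr (by omega), ?_⟩
    refine Finset.mem_filter.mpr ⟨Finset.mem_univ _, C, hcard, ?_⟩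
    rwa [← hcard]
  have hF : ∀ s ∈ Finset.range (2 * M),
      ((F s).card : ℝ) ≤ A * (n : ℝ) ^ (-(1 / 4) : ℝ) * (((s : ℝ) + 1) * (1 / 2) ^ s) * W := by
    intro s hs
    have hs' : s + 1 ≤ 2 * M := Finset.mem_range.mp hs
    have h1 := card_not_expanding_le (m := Δ * n) hk hn (isBlocking_partner hU).invol (s + 1)
      ((2 * k - t + ε) * ((s + 1 : ℕ) : ℝ))
    have h2 := expansion_failure_term_le (Δ := Δ) hU hUn s.succ_pos (hs'.trans hMn) hε hεt htk
    have h3 := pow_le_of_base_le_half hA0 s.succ_pos (hs'.trans hMn) rfl hθ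
      (hhalf (s + 1) s.succ_pos hs')
    rw [Nat.succ_sub_one, Nat.cast_succ] at h3
    refine h1.trans (mul_le_mul_of_nonneg_right (h2.trans ?_) (Nat.cast_nonneg _))
    rwa [Nat.cast_succ]
  calc _ ≤ (((Finset.range (2 * M)).biUnion F).card : ℝ) := by
        exact_mod_cast Finset.card_le_card hsub
    _ ≤ ∑ s ∈ Finset.range (2 * M), ((F s).card : ℝ) := by
        exact_mod_cast Finset.card_biUnion_le
    _ ≤ ∑ s ∈ Finset.range (2 * M),
          A * (n : ℝ) ^ (-(1 / 4) : ℝ) * (((s : ℝ) + 1) * (1 / 2) ^ s) * W :=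
        Finset.sum_le_sum hF
    _ = A * (n : ℝ) ^ (-(1 / 4) : ℝ)
          * (∑ s ∈ Finset.range (2 * M), ((s : ℝ) + 1) * (1 / 2) ^ s) * W := by
        rw [← Finset.sum_mul, Finset.mul_sum]
    _ ≤ A * (n : ℝ) ^ (-(1 / 4) : ℝ) * 4 * W := by
        gcongr
        exact sum_succ_mul_half_pow_le _
    _ = _ := by ring

lemma le_uprob_of_card_le {Ω : Type} [Fintype Ω] [Nonempty Ω] {p : Ω → Prop} (B : Finset Ω)
    {δ : ℝ} (hp : ∀ ω, ω ∉ B → p ω) (hB : (B.card : ℝ) ≤ δ * Fintype.card Ω) :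
    1 - δ ≤ uprob p := by
  classical
  have hW : (0 : ℝ) < Fintype.card Ω := by exact_mod_cast Fintype.card_pos
  rw [uprob, le_div_iff₀ hW]
  have h1 : Fintype.card Ω ≤ (Finset.univ.filter p).card + B.card := by
    rw [← Finset.card_univ]
    refine (Finset.card_le_card fun ω _ => ?_).trans (Finset.card_union_le _ _)
    by_cases h : ω ∈ B
    · exact Finset.mem_union_right _ h
    · exact Finset.mem_union_left _ (Finset.mem_filter.mpr ⟨Finset.mem_univ _, hp ω h⟩)
  have h2 : (Fintype.card Ω : ℝ) ≤ (Finset.univ.filter p).card + B.card := by exact_mod_cast h1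
  have h3 : (1 - δ) * (Fintype.card Ω : ℝ) ≤ ((Finset.univ.filter p).card : ℝ) := by linarith
  convert h3

lemma nonempty_instances {k n m : ℕ} (hkn : k ≤ n) :
    Nonempty (Fin m → (Fin k ↪ Fin n) × (Fin k → Bool)) :=
  ⟨fun _ => ((Fin.castLEEmb hkn), fun _ => false)⟩

end Probability

section Parameters

/-- The slack in the expansion requirement. -/
noncomputable def slack (Δ : ℕ) : ℝ := 1 / (4 * max (Real.log Δ) 1)

lemma slack_pos (Δ : ℕ) : 0 < slack Δ := by
  have : 0 < max (Real.log Δ) 1 := lt_max_of_lt_right one_pos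
  unfold slack
  positivity

lemma slack_le (Δ : ℕ) : slack Δ ≤ 1 / 4 := by
  have : 1 ≤ max (Real.log Δ) 1 := le_max_right _ _
  unfold slack
  exact one_div_le_one_div_of_le (by norm_num) (by linarith)

lemma rpow_slack_le {Δ : ℕ} (hΔ : 1 ≤ Δ) : (Δ : ℝ) ^ slack Δ ≤ 2 := by
  have hΔ' : (0 : ℝ) < Δ := by exact_mod_cast hΔ
  have hm : 0 < max (Real.log Δ) 1 := lt_max_of_lt_right one_pos
  have h1 : Real.log Δ * slack Δ ≤ 1 / 4 := by
    unfold slack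
    rw [mul_one_div, div_le_div_iff₀ (by positivity) (by norm_num)]
    linarith [le_max_left (Real.log Δ) 1]
  rw [Real.rpow_def_of_pos hΔ', ← Real.le_log_iff_exp_le (by norm_num)]
  linarith [Real.log_two_gt_d9]

lemma base_le_half {t Δ : ℕ} (ht : 3 ≤ t) (hΔ : 1 ≤ Δ) {K q : ℝ} (hK : 1 ≤ K) (hq0 : 0 ≤ q)
    (hq : q ≤ (1 / (4 * K)) ^ 4 * (Δ : ℝ) ^ (-((2 : ℝ) / ((t : ℝ) - 2)))) :
    K * Δ * q ^ ((t : ℝ) / 2 - 1 - slack Δ / 2) ≤ 1 / 2 := by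
  have hΔ' : (1 : ℝ) ≤ Δ := by exact_mod_cast hΔ
  have ht' : (3 : ℝ) ≤ t := by exact_mod_cast ht
  have hs0 := slack_pos Δ
  have hs1 := slack_le Δ
  set θ := (t : ℝ) / 2 - 1 - slack Δ / 2 with hθ
  have hθ4 : 1 / 4 ≤ θ := by linarith
  have hb0 : 0 < 1 / (4 * K) := by positivity
  have hb1 : 1 / (4 * K) ≤ 1 := by
    rw [div_le_one (by positivity)]
    linarith
  have h1 : ((1 / (4 * K)) ^ 4) ^ θ ≤ 1 / (4 * K) := by
    rw [← Real.rpow_natCast_mul hb0.le]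
    calc (1 / (4 * K)) ^ (((4 : ℕ) : ℝ) * θ) ≤ (1 / (4 * K)) ^ (1 : ℝ) :=
          Real.rpow_le_rpow_of_exponent_ge hb0 hb1 (by push_cast; linarith)
      _ = _ := Real.rpow_one _
  have h2 : (Δ : ℝ) * ((Δ : ℝ) ^ (-((2 : ℝ) / ((t : ℝ) - 2)))) ^ θ ≤ 2 := by
    have ht2 : 0 < (t : ℝ) - 2 := by linarith
    calc (Δ : ℝ) * ((Δ : ℝ) ^ (-((2 : ℝ) / ((t : ℝ) - 2)))) ^ θ
        = (Δ : ℝ) ^ (1 : ℝ) * (Δ : ℝ) ^ (-((2 : ℝ) / ((t : ℝ) - 2)) * θ) := by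
          rw [Real.rpow_one, Real.rpow_mul (by positivity)]
      _ = (Δ : ℝ) ^ (slack Δ / ((t : ℝ) - 2)) := by
          rw [← Real.rpow_add (by positivity)]
          congr 1
          rw [hθ]
          field_simp
          ring
      _ ≤ (Δ : ℝ) ^ slack Δ :=
          Real.rpow_le_rpow_of_exponent_le hΔ' (div_le_self hs0.le (by linarith))
      _ ≤ 2 := rpow_slack_le hΔ
  calc K * Δ * q ^ θ
      ≤ K * Δ * ((1 / (4 * K)) ^ 4 * (Δ : ℝ) ^ (-((2 : ℝ) / ((t : ℝ) - 2)))) ^ θ := by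
        gcongr
    _ = K * ((1 / (4 * K)) ^ 4) ^ θ * (Δ * ((Δ : ℝ) ^ (-((2 : ℝ) / ((t : ℝ) - 2)))) ^ θ) := by
        rw [Real.mul_rpow (by positivity) (by positivity)]
        ring
    _ ≤ K * (1 / (4 * K)) * 2 := by gcongr
    _ = 1 / 2 := by
        field_simp
        norm_num

lemma degree_le_of_slack {k t Δ n : ℕ} {κ : ℝ} (hk : 0 < k) (hκ : 0 < κ) (hΔ : 1 ≤ Δ) :
    κ / (64 * k) * n / ((Δ : ℝ) ^ ((2 : ℝ) / ((t : ℝ) - 2)) * Real.log Δ)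
      ≤ slack Δ / (2 * k) * (κ * (Δ : ℝ) ^ (-((2 : ℝ) / ((t : ℝ) - 2))) * n / 4) := by
  have hΔ' : (0 : ℝ) < Δ := by exact_mod_cast hΔ
  have hk' : (0 : ℝ) < k := by exact_mod_cast hk
  have hp : 0 < (Δ : ℝ) ^ ((2 : ℝ) / ((t : ℝ) - 2)) := Real.rpow_pos_of_pos hΔ' _
  have hs := slack_pos Δ
  rw [Real.rpow_neg hΔ'.le]
  rcases hΔ.eq_or_lt with rfl | h2
  · simp
    positivity
  · have hl : 1 / 2 ≤ Real.log Δ := by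
      have : Real.log 2 ≤ Real.log Δ :=
        Real.log_le_log (by norm_num) (by exact_mod_cast h2)
      linarith [Real.log_two_gt_d9]
    have hm : max (Real.log Δ) 1 ≤ 2 * Real.log Δ := max_le (by linarith) (by linarith)
    have hsl : 1 / (8 * Real.log Δ) ≤ slack Δ := by
      unfold slack
      have : 0 < max (Real.log Δ) 1 := lt_max_of_lt_right one_pos
      exact one_div_le_one_div_of_le (by positivity) (by linarith)
    set p := (Δ : ℝ) ^ ((2 : ℝ) / ((t : ℝ) - 2))
    calc κ / (64 * k) * n / (p * Real.log Δ)
        = 1 / (8 * Real.log Δ) / (2 * k) * (κ * p⁻¹ * n / 4) := by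
          field_simp
          ring
      _ ≤ _ := by gcongr

end Parameters

/-- The random constraints together with the planted ones, for predicates with at least `t`
inputs and positive density. -/
lemma eventually_exists_PE01 {k t Δ : ℕ} (ht : 3 ≤ t) (htk : t ≤ k) (hΔ : 1 ≤ Δ)
    {ν : (Fin k → Bool) → ℝ} (hdist : IsDist ν) (hwise : kwiseUniform (t - 1) ν) {Cu K δ : ℝ}
    (hCu : 0 < Cu) (hK : K = Real.exp (2 + Cu) * (4 * k) ^ k) (hδ : 0 < δ) :
    ∃ N : ℕ, ∀ n : ℕ, N ≤ n →
      ∀ U : ℕ, U ≤ n → 2 ∣ (n - U) → (U : ℝ) ≤ Cu * Real.sqrt (n : ℝ) →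
        ∀ b : Fin n → Bool,
          1 - δ ≤ uprob (fun ω : Fin (Δ * n) → (Fin k ↪ Fin n) × (Fin k → Bool) =>
            ∃ E : PE01 n
              ⌊(1 / (4 * K)) ^ 4 / (64 * k) * (n : ℝ)
                / ((Δ : ℝ) ^ ((2 : ℝ) / ((t : ℝ) - 2)) * Real.log Δ)⌋₊,
              SatisfiesAll ν U b ω E) := by
  have hk3 : (3 : ℝ) ≤ k := by exact_mod_cast ht.trans htk
  have ht3 : (3 : ℝ) ≤ t := by exact_mod_cast ht
  have hΔ' : (1 : ℝ) ≤ Δ := by exact_mod_cast hΔ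
  have hK1 : 1 ≤ K := by
    rw [hK]
    exact one_le_mul_of_one_le_of_one_le (Real.one_le_exp (by linarith))
      (one_le_pow₀ (by linarith))
  set κ := (1 / (4 * K)) ^ 4 with hκdef
  have hκ : 0 < κ := by positivity
  have hκ1 : κ ≤ 1 := by
    refine pow_le_one₀ (by positivity) ?_
    rw [div_le_one (by positivity)]
    linarith
  have hp1 : (Δ : ℝ) ^ (-((2 : ℝ) / ((t : ℝ) - 2))) ≤ 1 := by
    refine Real.rpow_le_one_of_one_le_of_nonpos hΔ' ?_
    have : 0 ≤ (2 : ℝ) / ((t : ℝ) - 2) := div_nonneg (by norm_num) (by linarith)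
    linarith
  have hp0 : 0 < (Δ : ℝ) ^ (-((2 : ℝ) / ((t : ℝ) - 2))) := Real.rpow_pos_of_pos (by linarith) _
  set σ₀ := κ * (Δ : ℝ) ^ (-((2 : ℝ) / ((t : ℝ) - 2))) with hσ₀
  have hσ0 : 0 < σ₀ := by positivity
  have hσ1 : σ₀ ≤ 1 := mul_le_one₀ hκ1 hp0.le hp1
  have hs0 := slack_pos Δ
  have hs1 := slack_le Δ
  set ε := slack Δ with hε
  set z := ε / (2 * k) with hz
  have hz0 : 0 < z := by positivity
  have hlim : Filter.Tendsto (fun n : ℕ => 4 * (K * Δ) * (n : ℝ) ^ (-(1 / 4) : ℝ)) Filter.atTop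
      (nhds 0) := by
    have := ((tendsto_rpow_neg_atTop (y := 1 / 4) (by norm_num)).comp
      tendsto_natCast_atTop_atTop).const_mul (4 * (K * Δ))
    simpa using this
  have hev : ∀ᶠ n : ℕ in Filter.atTop,
      4 * (K * Δ) * (n : ℝ) ^ (-(1 / 4) : ℝ) ≤ δ ∧ 4 / σ₀ ≤ n ∧ 8 * k / (z * σ₀) ≤ n ∧
        2 * k ≤ n :=
    (hlim.eventually_le_const hδ).and
      ((tendsto_natCast_atTop_atTop.eventually_ge_atTop _).and
        ((tendsto_natCast_atTop_atTop.eventually_ge_atTop _).and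
          (Filter.eventually_ge_atTop _)))
  obtain ⟨N, hN⟩ := Filter.eventually_atTop.mp hev
  refine ⟨N, fun n hn U _ hU hUn b => ?_⟩
  obtain ⟨hnδ, hn4, hn8, hnk⟩ := hN n hn
  have hn0 : 0 < n := by omega
  have hn0' : (0 : ℝ) < n := by exact_mod_cast hn0
  rw [div_le_iff₀ hσ0] at hn4
  rw [div_le_iff₀ (by positivity)] at hn8
  set M := ⌊σ₀ * n / 2⌋₊ with hMdef
  have hMle : (M : ℝ) ≤ σ₀ * n / 2 := Nat.floor_le (by positivity)
  have hMge : σ₀ * n / 4 ≤ M := by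
    have := Nat.lt_floor_add_one (σ₀ * n / 2)
    rw [← hMdef] at this
    linarith
  have hkM : 2 * (k : ℝ) ≤ z * M := by
    have : z * (σ₀ * n / 4) ≤ z * M := by gcongr
    linarith
  have hM1 : 1 ≤ M := by
    have : (0 : ℝ) < M := by nlinarith
    exact_mod_cast this
  have hMn : 2 * M ≤ n := by
    have : (2 * M : ℝ) ≤ n := by nlinarith
    exact_mod_cast this
  have := nonempty_instances (m := Δ * n) (k := k) (n := n) (by omega)
  refine le_uprob_of_card_le
    (Finset.univ.filter fun ω : Fin (Δ * n) → (Fin k ↪ Fin n) × (Fin k → Bool) =>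
        ∃ C : Finset (Fin (Δ * n)), C.Nonempty ∧ C.card ≤ 2 * M ∧
          ((blockHull (partner U hU) (C.biUnion fun j => Finset.univ.map (ω j).1)).card : ℝ)
            ≤ (2 * k - t + ε) * C.card) (fun ω hω => ?_) ?_
  · refine exists_PE01_of_expansion ht htk hdist hwise hU b ω hs0 (by linarith) hM1
      (fun C hC hCM => ?_) ?_ hkM
    · by_contra hlt
      exact hω (Finset.mem_filter.mpr ⟨Finset.mem_univ _, C, hC, hCM, (not_le.mp hlt).le⟩)
    · refine (Nat.floor_le ?_).trans ((degree_le_of_slack (by omega) hκ hΔ).trans ?_)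
      · have := Real.log_nonneg hΔ'
        positivity
      · rw [← hε, ← hz, ← hσ₀]
        gcongr
  · refine (card_not_expander_le hnk hn0 hU hUn hs0.le htk (by linarith) hMn (by linarith)
      fun s hs hsM => ?_).trans ?_
    · rw [← hK]
      refine base_le_half ht hΔ hK1 (by positivity) ?_
      rw [← hκdef, ← hσ₀, div_le_iff₀ hn0']
      have : (s : ℝ) ≤ 2 * M := by exact_mod_cast hsM
      linarith
    · rw [← hK]
      gcongr

/-- a random ν-distributional CSP together with deterministic unary constraints
`x_i = b_i` (i ≤ U) and a perfect matching of `≠`-constraints on the remaining variables is,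
with high probability, weakly satisfied by a pseudoexpectation of degree
Ω(n/(Δ^{2/(t-2)} log Δ)). -/
theorem stmt5 (k t : ℕ) (ht : 3 ≤ t) (ν : (Fin k → Bool) → ℝ)
    (hdist : IsDist ν) (hwise : kwiseUniform (t - 1) ν) :
    ∀ Cu : ℝ, 0 < Cu →
      ∃ c : ℝ, 0 < c ∧
        ∀ Δ : ℕ,
          ∀ δ : ℝ, 0 < δ →
            ∃ N : ℕ, ∀ n : ℕ, N ≤ n →
              ∀ U : ℕ, U ≤ n → 2 ∣ (n - U) → (U : ℝ) ≤ Cu * Real.sqrt (n : ℝ) →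
                ∀ b : Fin n → Bool,
                  1 - δ ≤
                    uprob (fun ω : Fin (Δ * n) → (Fin k ↪ Fin n) × (Fin k → Bool) =>
                      ∃ E : PE01 n
                          ⌊c * (n : ℝ) / ((Δ : ℝ) ^ ((2 : ℝ) / ((t : ℝ) - 2)) * Real.log Δ)⌋₊,
                        -- weak satisfaction of each random ν-constraint (ν reoriented by the
                        -- random negation pattern)
                        (∀ j : Fin (Δ * n),
                          E.satEq
                            (∑ a ∈ rsupp (fun a : Fin k → Bool =>
                                ν (fun i => Bool.xor (a i) ((ω j).2 i))),
                              ind01 (fun i => (ω j).1 i) a) 1) ∧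
                        -- weak satisfaction of the unary constraints x_i = b_i for i < U
                        (∀ i : Fin n, (i : ℕ) < U →
                          E.satEq
                            (if b i then MvPolynomial.X i else 1 - MvPolynomial.X i) 1) ∧
                        -- weak satisfaction of the matching constraints: (x_a, x_{a+1})
                        -- uniform on {(0,1),(1,0)} for a = U, U+2, U+4, …
                        (∀ a a' : Fin n, U ≤ (a : ℕ) → ((a : ℕ) - U) % 2 = 0 →
                          (a' : ℕ) = (a : ℕ) + 1 →
                          E.satEq
                            (MvPolynomial.X a * (1 - MvPolynomial.X a')
                              + (1 - MvPolynomial.X a) * MvPolynomial.X a') 1)) := by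
  intro Cu hCu
  have hfull : ∀ (c δ : ℝ) (Δ n U : ℕ) (b : Fin n → Bool), 0 < δ → k ≤ n →
      (Fin (Δ * n) → ∀ y, ν y ≠ 0) →
      1 - δ ≤ uprob (fun ω : Fin (Δ * n) → (Fin k ↪ Fin n) × (Fin k → Bool) =>
        ∃ E : PE01 n
          ⌊c * (n : ℝ) / ((Δ : ℝ) ^ ((2 : ℝ) / ((t : ℝ) - 2)) * Real.log Δ)⌋₊,
          SatisfiesAll ν U b ω E) := by
    intro c δ Δ n U b hδ hkn hν
    have := nonempty_instances (m := Δ * n) hkn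
    refine le_uprob_of_card_le ∅ (fun ω _ => exists_PE01_of_full_support b ω hν) ?_
    rw [Finset.card_empty, Nat.cast_zero]
    positivity
  rcases lt_or_ge k t with hkt | htk
  · refine ⟨1, one_pos, fun Δ δ hδ => ⟨k, fun n hn U _ _ _ b => ?_⟩⟩
    exact hfull 1 δ Δ n U b hδ hn fun _ => ne_zero_of_kwiseUniform hwise (by omega)
  · have hk : 0 < k := by omega
    refine ⟨(1 / (4 * (Real.exp (2 + Cu) * (4 * k) ^ k))) ^ 4 / (64 * k), by positivity,
      fun Δ δ hδ => ?_⟩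
    rcases Nat.eq_zero_or_pos Δ with rfl | hΔ
    · refine ⟨k, fun n hn U _ _ _ b => ?_⟩
      exact hfull _ δ 0 n U b hδ hn fun j => absurd j.isLt (by simp)
    · exact eventually_exists_PE01 ht htk hΔ hdist hwise hCu rfl hδ
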